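/- arXiv:2603.08886 — 3 statements merged into one kernel-verified Lean document; each statement's English description precedes it below -/
import Mathlib

section
/- Let W be a memoryless surjective channel on finite alphabets 𝒳 and 𝒴 with distinguished set S ⊆ 𝒳, |S| = |𝒴|. There exists δ > 0 such that for every W-centered δ-approximately memoryless POST channel Q: the optimization problem defining C*_f(Q) — maximize I(X;Y|Y′) over joint pmfs P on 𝒳 × 𝒴 subject to ∑_{x,y′} P(x,y′) Q(y|x,y′) = ∑_x P(x,y) for all y — has a unique maximizer P*, and its X-marginal P*_X is supported on S, i.e., P*_X(x) = 0 for all x ∈ 𝒳∖S. Moreover, for every ε > 0 there exists δ > 0 such that for every such Q, every maximizer P* satisfies max_{x,y} |P*(x,y) − P_X^W(x) P_Y^W(y)| ≤ ε. -/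
open scoped BigOperators

noncomputable section

/-- Conditional mutual information `I(A;B|C)` for a joint pmf `P` on finite types,
with the conventions `0 · log 0 = 0` (and division by zero equal to zero)
and natural logarithm. -/
def condMI {A B C : Type*} [Fintype A] [Fintype B] [Fintype C]
    (P : A → B → C → ℝ) : ℝ :=
  ∑ a : A, ∑ b : B, ∑ c : C,
    P a b c *
      Real.log ((P a b c * ∑ a' : A, ∑ b' : B, P a' b' c) /
        ((∑ b' : B, P a b' c) * (∑ a' : A, P a' b c)))

/-- `Q x y' y` represents the POST-channel transition kernel `Q(y | x, y')`. -/
def IsPOST {X Y : Type*} [Fintype X] [Fintype Y] (Q : X → Y → Y → ℝ) : Prop :=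
  (∀ x y' y, 0 ≤ Q x y' y) ∧ ∀ x y', ∑ y : Y, Q x y' y = 1

/-- A joint pmf `P(x, y')` on `X × Y`. -/
def IsJointPmf {X Y : Type*} [Fintype X] [Fintype Y] (P : X → Y → ℝ) : Prop :=
  (∀ x y, 0 ≤ P x y) ∧ ∑ x : X, ∑ y : Y, P x y = 1

/-- The stationarity constraint `∑_{x,y'} P(x,y') Q(y|x,y') = ∑_x P(x,y)` for all `y`. -/
def StationaryFor {X Y : Type*} [Fintype X] [Fintype Y]
    (Q : X → Y → Y → ℝ) (P : X → Y → ℝ) : Prop :=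
  ∀ y : Y, ∑ x : X, ∑ y' : Y, P x y' * Q x y' y = ∑ x : X, P x y

/-- `I(X;Y|Y')` computed under the joint law `P(x,y') Q(y|x,y')`. -/
def fbMI {X Y : Type*} [Fintype X] [Fintype Y]
    (Q : X → Y → Y → ℝ) (P : X → Y → ℝ) : ℝ :=
  condMI (fun (x : X) (y : Y) (y' : Y) => P x y' * Q x y' y)

/-- `P` is a maximizer of the optimization problem defining `C*_f(Q)`. -/
def IsFbMaximizer {X Y : Type*} [Fintype X] [Fintype Y]
    (Q : X → Y → Y → ℝ) (P : X → Y → ℝ) : Prop :=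
  IsJointPmf P ∧ StationaryFor Q P ∧
    ∀ P' : X → Y → ℝ, IsJointPmf P' → StationaryFor Q P' → fbMI Q P' ≤ fbMI Q P

/-- The feedback capacity functional `C*_f(Q)`. -/
def Cfstar {X Y : Type*} [Fintype X] [Fintype Y] (Q : X → Y → Y → ℝ) : ℝ :=
  sSup {r : ℝ | ∃ P : X → Y → ℝ, IsJointPmf P ∧ StationaryFor Q P ∧ fbMI Q P = r}

/-- The state preceding time `t` in a length-`n` block with initial state `y0`. -/
def prevState {Y : Type*} (n : ℕ) (y0 : Y) (ys : Fin n → Y) (t : Fin n) : Y :=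
  if (t : ℕ) = 0 then y0
  else ys ⟨(t : ℕ) - 1, lt_of_le_of_lt (Nat.sub_le _ _) t.isLt⟩

/-- A joint pmf `P(x^n, y_0)` on `𝒳^n × 𝒴`. -/
def IsJointPmfN {X Y : Type*} [Fintype X] [Fintype Y] (n : ℕ)
    (P : (Fin n → X) → Y → ℝ) : Prop :=
  (∀ xs y0, 0 ≤ P xs y0) ∧ ∑ xs : Fin n → X, ∑ y0 : Y, P xs y0 = 1

/-- The induced joint law `P(x^n,y_0) ∏_{t=1}^n Q(y_t|x_t,y_{t-1})`. -/
def nLaw {X Y : Type*} [Fintype X] [Fintype Y]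
    (Q : X → Y → Y → ℝ) (n : ℕ) (P : (Fin n → X) → Y → ℝ) :
    (Fin n → X) → (Fin n → Y) → Y → ℝ :=
  fun xs ys y0 => P xs y0 * ∏ t : Fin n, Q (xs t) (prevState n y0 ys t) (ys t)

/-- `C_n(Q) = (1/n) max_{P_{X^n Y_0}} I(X^n; Y^n | Y_0)`. -/
def Cn {X Y : Type*} [Fintype X] [Fintype Y] (Q : X → Y → Y → ℝ) (n : ℕ) : ℝ :=
  sSup {r : ℝ | ∃ P : (Fin n → X) → Y → ℝ, IsJointPmfN n P ∧
    r = (1 / (n : ℝ)) * condMI (nLaw Q n P)}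

/-- A pmf on a finite set. -/
def IsPmf {X : Type*} [Fintype X] (p : X → ℝ) : Prop :=
  (∀ x, 0 ≤ p x) ∧ ∑ x : X, p x = 1

/-- The mutual information `I(X;Y)` across the memoryless channel `W` with input pmf `p`. -/
def mlMI {X Y : Type*} [Fintype X] [Fintype Y] (W : X → Y → ℝ) (p : X → ℝ) : ℝ :=
  ∑ x : X, ∑ y : Y, p x * W x y * Real.log (W x y / ∑ x' : X, p x' * W x' y)

/-- The conditional output kernel `P_{Y|Y'}(y|y') = ∑_x P_{X|Y'}(x|y') Q(y|x,y')`. -/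
def condOut {X Y : Type*} [Fintype X] [Fintype Y]
    (Q : X → Y → Y → ℝ) (P : X → Y → ℝ) (y' y : Y) : ℝ :=
  (∑ x : X, P x y' * Q x y' y) / (∑ x : X, P x y')

namespace RMP
open Filter Topology

/-- Continuous form of the objective. -/
def FF {X Y : Type*} [Fintype X] [Fintype Y] (Q : X → Y → Y → ℝ) (P : X → Y → ℝ) : ℝ :=
  ∑ x : X, ∑ y' : Y, P x y' * ∑ y : Y, Q x y' y * Real.log (Q x y' y)
  - ∑ y' : Y, ∑ y : Y, (∑ x : X, P x y' * Q x y' y) * Real.log (∑ x : X, P x y' * Q x y' y)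
  + ∑ y' : Y, (∑ x : X, P x y') * Real.log (∑ x : X, P x y')

lemma continuous_FF {X Y : Type*} [Fintype X] [Fintype Y] :
    Continuous (fun z : (X → Y → Y → ℝ) × (X → Y → ℝ) => FF z.1 z.2) := by
  unfold FF
  have hl := Real.continuous_mul_log
  have h1 : ∀ x y' y, Continuous (fun z : (X → Y → Y → ℝ) × (X → Y → ℝ) =>
      z.1 x y' y * Real.log (z.1 x y' y)) := fun x y' y =>
    hl.comp (by fun_prop : Continuous (fun z : (X → Y → Y → ℝ) × (X → Y → ℝ) => z.1 x y' y))
  have h2 : ∀ y' y, Continuous (fun z : (X → Y → Y → ℝ) × (X → Y → ℝ) =>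
      (∑ x : X, z.2 x y' * z.1 x y' y) * Real.log (∑ x : X, z.2 x y' * z.1 x y' y)) :=
    fun y' y => hl.comp (by fun_prop : Continuous
      (fun z : (X → Y → Y → ℝ) × (X → Y → ℝ) => ∑ x : X, z.2 x y' * z.1 x y' y))
  have h3 : ∀ y', Continuous (fun z : (X → Y → Y → ℝ) × (X → Y → ℝ) =>
      (∑ x : X, z.2 x y') * Real.log (∑ x : X, z.2 x y')) :=
    fun y' => hl.comp (by fun_prop : Continuous
      (fun z : (X → Y → Y → ℝ) × (X → Y → ℝ) => ∑ x : X, z.2 x y'))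
  fun_prop

lemma cont_ref_aux {A B : Type*} [TopologicalSpace A] [TopologicalSpace B] {g : A × B → ℝ}
    (hg : Continuous g) {f : A → B} {a : A} (hf : ContinuousAt f a) (b : B) :
    ContinuousAt (fun z : A × B => g (z.1, f z.1)) (a, b) := by
  have h0 : ContinuousAt (fun z : A × B => f z.1) (a, b) :=
    Tendsto.comp hf (continuous_fst.tendsto (a, b))
  exact Tendsto.comp (hg.tendsto (a, f a)) (continuousAt_fst.prodMk h0)

lemma cont_FF_ref {X Y : Type*} [Fintype X] [Fintype Y] {f : (X → Y → Y → ℝ) → X → Y → ℝ}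
    {Q : X → Y → Y → ℝ} (hf : ContinuousAt f Q) (P : X → Y → ℝ) :
    ContinuousAt (fun z : (X → Y → Y → ℝ) × (X → Y → ℝ) => FF z.1 (f z.1)) (Q, P) :=
  cont_ref_aux (g := fun z : (X → Y → Y → ℝ) × (X → Y → ℝ) => FF z.1 z.2) continuous_FF hf P

lemma fbMI_eq {X Y : Type*} [Fintype X] [Fintype Y] {Q : X → Y → Y → ℝ} {P : X → Y → ℝ}
    (hQ : IsPOST Q) (hP : ∀ x y, 0 ≤ P x y) : fbMI Q P = FF Q P := by
  unfold fbMI condMI FF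
  have hb : ∀ x y', ∑ y, P x y' * Q x y' y = P x y' := fun x y' => by
    rw [← Finset.mul_sum, hQ.2, mul_one]
  simp only [hb]
  have key : ∀ x y y', P x y' * Q x y' y * Real.log ((P x y' * Q x y' y * ∑ a, P a y') /
      (P x y' * ∑ a, P a y' * Q a y' y)) = P x y' * (Q x y' y * Real.log (Q x y' y))
        + P x y' * Q x y' y * Real.log (∑ a, P a y')
        - P x y' * Q x y' y * Real.log (∑ a, P a y' * Q a y' y) := by
    intro x y y'
    by_cases h1 : P x y' = 0
    · simp [h1]
    by_cases h2 : Q x y' y = 0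
    · simp [h2]
    have p1 : 0 < P x y' := lt_of_le_of_ne (hP _ _) (Ne.symm h1)
    have p2 : 0 < Q x y' y := lt_of_le_of_ne (hQ.1 _ _ _) (Ne.symm h2)
    have s1 : 0 < ∑ a, P a y' := lt_of_lt_of_le p1
      (Finset.single_le_sum (f := fun a => P a y') (fun a _ => hP a y') (Finset.mem_univ x))
    have s2 : 0 < ∑ a, P a y' * Q a y' y := lt_of_lt_of_le (mul_pos p1 p2)
      (Finset.single_le_sum (f := fun a => P a y' * Q a y' y)
        (fun a _ => mul_nonneg (hP a y') (hQ.1 _ _ _)) (Finset.mem_univ x))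
    rw [mul_assoc (P x y') (Q x y' y) (∑ a, P a y'), mul_div_mul_left _ _ h1,
      Real.log_div (by positivity) s2.ne', Real.log_mul h2 s1.ne']
    ring
  simp only [key, Finset.sum_add_distrib, Finset.sum_sub_distrib]
  have e1 : ∑ x, ∑ y, ∑ y', P x y' * (Q x y' y * Real.log (Q x y' y))
      = ∑ x, ∑ y', P x y' * ∑ y, Q x y' y * Real.log (Q x y' y) := by
    refine Finset.sum_congr rfl fun x _ => ?_
    rw [Finset.sum_comm]
    simp only [Finset.mul_sum]
  have e2 : ∑ x, ∑ y, ∑ y', P x y' * Q x y' y * Real.log (∑ a, P a y')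
      = ∑ y', (∑ x, P x y') * Real.log (∑ x, P x y') := by
    calc _ = ∑ x, ∑ y', ∑ y, P x y' * Q x y' y * Real.log (∑ a, P a y') :=
          Finset.sum_congr rfl fun x _ => Finset.sum_comm
      _ = ∑ x, ∑ y', P x y' * Real.log (∑ a, P a y') := by
          simp only [← Finset.sum_mul, hb]
      _ = _ := by rw [Finset.sum_comm]; simp only [← Finset.sum_mul]
  have e3 : ∑ x, ∑ y, ∑ y', P x y' * Q x y' y * Real.log (∑ a, P a y' * Q a y' y)
      = ∑ y', ∑ y, (∑ x, P x y' * Q x y' y) * Real.log (∑ x, P x y' * Q x y' y) := by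
    calc _ = ∑ x, ∑ y', ∑ y, P x y' * Q x y' y * Real.log (∑ a, P a y' * Q a y' y) :=
          Finset.sum_congr rfl fun x _ => Finset.sum_comm
      _ = ∑ y', ∑ x, ∑ y, P x y' * Q x y' y * Real.log (∑ a, P a y' * Q a y' y) :=
          Finset.sum_comm
      _ = ∑ y', ∑ y, ∑ x, P x y' * Q x y' y * Real.log (∑ a, P a y' * Q a y' y) :=
          Finset.sum_congr rfl fun x _ => Finset.sum_comm
      _ = _ := by simp only [← Finset.sum_mul]
  rw [e1, e2, e3]; ring

lemma kl_ge {r s : ℝ} (hr : 0 ≤ r) (hs : 0 ≤ s) (h : s = 0 → r = 0) :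
    r - s ≤ r * Real.log r - r * Real.log s := by
  rcases hr.eq_or_lt with h0 | h0
  · subst h0; simpa using hs
  have hs' : 0 < s := lt_of_le_of_ne hs (fun h' => h0.ne' (h h'.symm))
  have := Real.log_le_sub_one_of_pos (div_pos hs' h0)
  rw [Real.log_div hs'.ne' h0.ne'] at this
  have h2 := mul_le_mul_of_nonneg_left this h0.le
  have h3 : r * (s / r - 1) = s - r := by field_simp
  rw [h3] at h2
  linarith

lemma kl_eq {r s : ℝ} (hr : 0 ≤ r) (hs : 0 ≤ s) (h : s = 0 → r = 0)
    (he : r * Real.log r - r * Real.log s ≤ r - s) : r = s := by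
  rcases hr.eq_or_lt with h0 | h0
  · subst h0; simp at he; linarith
  have hs' : 0 < s := lt_of_le_of_ne hs (fun h' => h0.ne' (h h'.symm))
  by_contra hne
  have hne1 : s / r ≠ 1 := fun h' => hne (by rw [div_eq_one_iff_eq h0.ne'] at h'; exact h'.symm)
  have := Real.log_lt_sub_one_of_pos (div_pos hs' h0) hne1
  rw [Real.log_div hs'.ne' h0.ne'] at this
  have h2 := mul_lt_mul_of_pos_left this h0
  have h3 : r * (s / r - 1) = s - r := by field_simp
  rw [h3] at h2
  linarith

lemma stat_unique {Y : Type*} [Fintype Y] [Nonempty Y] {p q : Y → ℝ} {K : Y → Y → ℝ}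
    (hq : ∀ y, 0 < q y) (hp1 : ∑ y, p y = 1) (hq1 : ∑ y, q y = 1)
    (hK : ∀ a b, 0 < K a b) (hp : ∀ y, ∑ a, p a * K a y = p y)
    (hqs : ∀ y, ∑ a, q a * K a y = q y) : p = q := by
  obtain ⟨m, hm⟩ := Finite.exists_min (fun y => p y / q y)
  set c := p m / q m with hc
  have hnn : ∀ y, 0 ≤ p y - c * q y := fun y => by
    have := hm y
    rw [le_div_iff₀ (hq y)] at this
    linarith
  have h0 : ∑ a, (p a - c * q a) * K a m = 0 := by
    simp only [sub_mul, Finset.sum_sub_distrib, mul_assoc, ← Finset.mul_sum, hp, hqs]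
    rw [hc]; have := (hq m).ne'; field_simp; ring
  rw [Finset.sum_eq_zero_iff_of_nonneg (fun a _ => mul_nonneg (hnn a) (hK a m).le)] at h0
  have hall : ∀ a, p a = c * q a := fun a => by
    have := h0 a (Finset.mem_univ a)
    rcases mul_eq_zero.1 this with h | h
    · linarith
    · exact absurd h (hK a m).ne'
  have hc1 : c = 1 := by
    have : ∑ a, p a = c * ∑ a, q a := by rw [Finset.mul_sum]; exact Finset.sum_congr rfl fun a _ => hall a
    rw [hp1, hq1] at this; linarith
  funext a; rw [hall a, hc1, one_mul]

/-- Continuous solving of linear systems near `W`. -/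
lemma solve {X Y : Type*} [Fintype X] [Fintype Y] [DecidableEq X] [DecidableEq Y]
    (W : X → Y → ℝ) (S : Finset X) (hScard : S.card = Fintype.card Y)
    (hSrank : LinearIndependent ℝ (fun x : S => W x.val)) :
    ∃ sol : (X → Y → ℝ) → (Y → ℝ) → X → ℝ,
      (∀ᶠ G in 𝓝 W, (∀ v y, ∑ x, sol G v x * G x y = v y) ∧
        ∀ c c' : X → ℝ, (∀ x ∉ S, c x = 0) → (∀ x ∉ S, c' x = 0) →
          (∀ y, ∑ x, c x * G x y = ∑ x, c' x * G x y) → c = c') ∧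
      (∀ G v, ∀ x ∉ S, sol G v x = 0) ∧
      (∀ v x, ContinuousAt (fun z : (X → Y → ℝ) × (Y → ℝ) => sol z.1 z.2 x) (W, v)) := by
  classical
  have hcard : Fintype.card S = Fintype.card Y := by simpa using hScard
  let e : S ≃ Y := Fintype.equivOfCardEq hcard
  let A : (X → Y → ℝ) → Matrix Y Y ℝ := fun G => Matrix.of fun i y => G (e.symm i).val y
  have hAc : Continuous A := by
    refine continuous_matrix fun i j => ?_
    simp only [A, Matrix.of_apply]; fun_prop
  have hdet : (A W).det ≠ 0 := by
    have : LinearIndependent ℝ (A W).row := by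
      have := hSrank.comp e.symm e.symm.injective
      exact this
    rw [Matrix.linearIndependent_rows_iff_isUnit, Matrix.isUnit_iff_isUnit_det] at this
    exact this.ne_zero
  have hsum : ∀ (c : X → ℝ) (G : X → Y → ℝ), (∀ x ∉ S, c x = 0) → ∀ y,
      ∑ x, c x * G x y = Matrix.vecMul (fun i => c (e.symm i).val) (A G) y := by
    intro c G hc y
    rw [Matrix.vecMul, dotProduct]
    simp only [A, Matrix.of_apply]
    rw [Equiv.sum_comp e.symm (fun s : S => c s.val * G s.val y), Finset.sum_coe_sort S (fun x => c x * G x y)]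
    symm
    apply Finset.sum_subset (Finset.subset_univ _)
    intro x _ hx; simp [hc x hx]
  refine ⟨fun G v x => if h : x ∈ S then Matrix.vecMul v ((A G).det⁻¹ • (A G).adjugate) (e ⟨x, h⟩) else 0,
    ?_, ?_, ?_⟩
  · have hev : ∀ᶠ G in 𝓝 W, (A G).det ≠ 0 :=
      (hAc.matrix_det.continuousAt (x := W)).eventually_ne hdet
    filter_upwards [hev] with G hG
    refine ⟨fun v y => ?_, fun c c' hc hc' h => ?_⟩
    · rw [hsum _ _ (fun x hx => by simp [hx])]
      have : (fun i => if h : (e.symm i).val ∈ S then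
          Matrix.vecMul v ((A G).det⁻¹ • (A G).adjugate) (e ⟨(e.symm i).val, h⟩) else 0)
          = Matrix.vecMul v ((A G).det⁻¹ • (A G).adjugate) := by
        funext i; simp
      rw [this, Matrix.vecMul_vecMul, Matrix.smul_mul, Matrix.adjugate_mul, smul_smul,
        inv_mul_cancel₀ hG, one_smul, Matrix.vecMul_one]
    · have h2 : Matrix.vecMul (fun i => c (e.symm i).val) (A G)
          = Matrix.vecMul (fun i => c' (e.symm i).val) (A G) := by
        funext y; rw [← hsum c G hc, ← hsum c' G hc', h]
      have hu : IsUnit (A G) := by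
        rw [Matrix.isUnit_iff_isUnit_det]; exact isUnit_iff_ne_zero.2 hG
      have h3 := Matrix.vecMul_injective_of_isUnit hu h2
      funext x
      by_cases hx : x ∈ S
      · have := congrFun h3 (e ⟨x, hx⟩); simpa using this
      · rw [hc x hx, hc' x hx]
  · intro G v x hx; simp [hx]
  · intro v x
    by_cases hx : x ∈ S
    · simp only [hx, dif_pos, Matrix.vecMul, dotProduct, Matrix.smul_apply, smul_eq_mul]
      have hA1 : Continuous (fun z : (X → Y → ℝ) × (Y → ℝ) => A z.1) := hAc.comp continuous_fst
      have c1 : ContinuousAt (fun z : (X → Y → ℝ) × (Y → ℝ) => (A z.1).det⁻¹) (W, v) :=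
        hA1.matrix_det.continuousAt.inv₀ hdet
      have c2 : ∀ i j, Continuous (fun z : (X → Y → ℝ) × (Y → ℝ) => (A z.1).adjugate i j) :=
        fun i j => hA1.matrix_adjugate.matrix_elem i j
      refine tendsto_finsetSum _ fun i _ => ?_
      have c3 : Continuous (fun z : (X → Y → ℝ) × (Y → ℝ) => z.2 i) := by fun_prop
      exact c3.continuousAt.mul (c1.mul (c2 i _).continuousAt)
    · simp only [hx, dif_neg, not_false_eq_true]; exact continuousAt_const

lemma FF_W {X Y : Type*} [Fintype X] [Fintype Y] {W : X → Y → ℝ}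
    (hW1 : ∀ x, ∑ y : Y, W x y = 1) {q : Y → ℝ} (hq : ∀ y, 0 < q y)
    {P : X → Y → ℝ} (hP : ∀ x y, 0 ≤ P x y) :
    FF (fun x _ y => W x y) P
      = ∑ x, (∑ y', P x y') * (∑ y, W x y * Real.log (W x y / q y))
        - ∑ y', ∑ y, ((∑ x, P x y' * W x y) * Real.log (∑ x, P x y' * W x y)
          - (∑ x, P x y' * W x y) * Real.log (q y * ∑ x, P x y')) := by
  unfold FF
  have hD : ∀ x, ∑ y, W x y * Real.log (W x y / q y)
      = ∑ y, W x y * Real.log (W x y) - ∑ y, W x y * Real.log (q y) := by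
    intro x
    rw [← Finset.sum_sub_distrib]
    refine Finset.sum_congr rfl fun y _ => ?_
    by_cases h : W x y = 0
    · simp [h]
    · rw [Real.log_div h (hq y).ne']; ring
  have hl : ∀ y' y, (∑ x, P x y' * W x y) * Real.log (q y * ∑ x, P x y')
      = (∑ x, P x y' * W x y) * Real.log (q y)
        + (∑ x, P x y' * W x y) * Real.log (∑ x, P x y') := by
    intro y' y
    by_cases h : ∑ x, P x y' = 0
    · rw [Finset.sum_eq_zero_iff_of_nonneg (fun a _ => hP a y')] at h
      have : ∑ x, P x y' * W x y = 0 :=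
        Finset.sum_eq_zero fun x hx => by rw [h x hx, zero_mul]
      simp [this]
    · rw [Real.log_mul (hq y).ne' h]; ring
  simp only [hD, hl, Finset.sum_sub_distrib, Finset.sum_add_distrib, mul_sub]
  have e1 : ∑ y', ∑ y, (∑ x, P x y' * W x y) * Real.log (∑ x, P x y')
      = ∑ y', (∑ x, P x y') * Real.log (∑ x, P x y') := by
    refine Finset.sum_congr rfl fun y' _ => ?_
    rw [← Finset.sum_mul, Finset.sum_comm]
    simp only [← Finset.mul_sum, hW1, mul_one]
  have e2 : ∑ y', ∑ y, (∑ x, P x y' * W x y) * Real.log (q y)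
      = ∑ x, (∑ y', P x y') * ∑ y, W x y * Real.log (q y) := by
    simp only [Finset.sum_mul, Finset.mul_sum]
    calc _ = ∑ y', ∑ x, ∑ y, P x y' * W x y * Real.log (q y) :=
          Finset.sum_congr rfl fun x _ => Finset.sum_comm
      _ = ∑ x, ∑ y', ∑ y, P x y' * W x y * Real.log (q y) := Finset.sum_comm
      _ = _ := by
          simp only [mul_assoc]
          exact Finset.sum_congr rfl fun x _ => Finset.sum_comm
  rw [e1, e2]
  simp only [← Finset.sum_mul]
  ring

lemma W_char {X Y : Type*} [Fintype X] [Fintype Y] {W : X → Y → ℝ} (hW0 : ∀ x y, 0 ≤ W x y)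
    (hW1 : ∀ x, ∑ y : Y, W x y = 1) {q : Y → ℝ} (hq : ∀ y, 0 < q y) (hq1 : ∑ y, q y = 1)
    {S : Finset X} {C : ℝ}
    (hSeq : ∀ x ∈ S, ∑ y : Y, W x y * Real.log (W x y / q y) = C)
    (hSlt : ∀ x ∉ S, ∑ y : Y, W x y * Real.log (W x y / q y) < C)
    {P : X → Y → ℝ} (hP : IsJointPmf P) (hst : StationaryFor (fun x _ y => W x y) P)
    (hC : C ≤ FF (fun x _ y => W x y) P) :
    (∀ x ∉ S, ∀ y, P x y = 0) ∧ ∀ y' y, ∑ x, P x y' * W x y = q y * q y' := by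
  rw [FF_W hW1 hq hP.1] at hC
  have hle : ∀ x, ∑ y : Y, W x y * Real.log (W x y / q y) ≤ C := fun x => by
    by_cases h : x ∈ S
    · exact (hSeq x h).le
    · exact (hSlt x h).le
  have hPx : ∀ x, 0 ≤ ∑ y', P x y' := fun x => Finset.sum_nonneg fun y _ => hP.1 x y
  have hr0 : ∀ y' y, 0 ≤ ∑ x, P x y' * W x y := fun y' y =>
    Finset.sum_nonneg fun x _ => mul_nonneg (hP.1 _ _) (hW0 _ _)
  have hs0 : ∀ y' y, 0 ≤ q y * ∑ x, P x y' := fun y' y =>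
    mul_nonneg (hq y).le (Finset.sum_nonneg fun x _ => hP.1 _ _)
  have hz : ∀ y' y, q y * ∑ x, P x y' = 0 → ∑ x, P x y' * W x y = 0 := by
    intro y' y h
    have h := (mul_eq_zero.1 h).resolve_left (hq y).ne'
    rw [Finset.sum_eq_zero_iff_of_nonneg (fun a _ => hP.1 a y')] at h
    exact Finset.sum_eq_zero fun x hx => by rw [h x hx, zero_mul]
  have hkl := fun y' y => kl_ge (hr0 y' y) (hs0 y' y) (hz y' y)
  have hrs : ∑ y', ∑ y, ((∑ x, P x y' * W x y) - q y * ∑ x, P x y') = 0 := by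
    refine Finset.sum_eq_zero fun y' _ => ?_
    rw [Finset.sum_sub_distrib, Finset.sum_comm, ← Finset.sum_mul, hq1]
    simp only [← Finset.mul_sum, hW1, mul_one, one_mul, sub_self]
  have hA : C - ∑ x, (∑ y', P x y') * (∑ y, W x y * Real.log (W x y / q y))
      = ∑ x, (∑ y', P x y') * (C - ∑ y, W x y * Real.log (W x y / q y)) := by
    simp only [mul_sub, Finset.sum_sub_distrib, ← Finset.sum_mul, hP.2, one_mul]
  have hB : ∑ y', ∑ y, ((∑ x, P x y' * W x y) * Real.log (∑ x, P x y' * W x y)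
          - (∑ x, P x y' * W x y) * Real.log (q y * ∑ x, P x y'))
      = ∑ y', ∑ y, ((∑ x, P x y' * W x y) * Real.log (∑ x, P x y' * W x y)
          - (∑ x, P x y' * W x y) * Real.log (q y * ∑ x, P x y')
          - ((∑ x, P x y' * W x y) - q y * ∑ x, P x y')) := by
    have : ∀ f g : Y → Y → ℝ, ∑ a, ∑ b, g a b = 0 →
        ∑ a, ∑ b, f a b = ∑ a, ∑ b, (f a b - g a b) := by
      intro f g h; simp only [Finset.sum_sub_distrib, h, sub_zero]
    exact this _ _ hrs
  have hAn : ∀ x, 0 ≤ (∑ y', P x y') * (C - ∑ y, W x y * Real.log (W x y / q y)) :=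
    fun x => mul_nonneg (hPx x) (sub_nonneg.2 (hle x))
  have hBn := fun y' y => sub_nonneg.2 (hkl y' y)
  have hA0 := Finset.sum_nonneg (s := Finset.univ) fun x _ => hAn x
  have hB0 := Finset.sum_nonneg (s := Finset.univ) fun y' _ =>
    Finset.sum_nonneg (s := Finset.univ) fun y _ => hBn y' y
  have hAz : ∑ x, (∑ y', P x y') * (C - ∑ y, W x y * Real.log (W x y / q y)) = 0 := by linarith
  have hBz := le_antisymm (by linarith) hB0
  rw [Finset.sum_eq_zero_iff_of_nonneg (fun x _ => hAn x)] at hAz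
  rw [Finset.sum_eq_zero_iff_of_nonneg
    (fun y' _ => Finset.sum_nonneg (s := Finset.univ) fun y _ => hBn y' y)] at hBz
  have hr : ∀ y' y, ∑ x, P x y' * W x y = q y * ∑ x, P x y' := by
    intro y' y
    have h1 := hBz y' (Finset.mem_univ _)
    rw [Finset.sum_eq_zero_iff_of_nonneg (fun y _ => hBn y' y)] at h1
    have h2 := h1 y (Finset.mem_univ _)
    exact kl_eq (hr0 y' y) (hs0 y' y) (hz y' y) (by linarith)
  have hp : ∀ y, ∑ x, P x y = q y := by
    intro y
    rw [← hst y, Finset.sum_comm]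
    simp only [hr]
    rw [← Finset.mul_sum, Finset.sum_comm, hP.2, mul_one]
  refine ⟨fun x hx y => ?_, fun y' y => by rw [hr, hp]⟩
  have h1 := hAz x (Finset.mem_univ _)
  have h2 := (mul_eq_zero.1 h1).resolve_right (sub_pos.2 (hSlt x hx)).ne'
  rw [Finset.sum_eq_zero_iff_of_nonneg (fun y _ => hP.1 x y)] at h2
  exact h2 y (Finset.mem_univ _)

lemma FF_W_opt {X Y : Type*} [Fintype X] [Fintype Y] {W : X → Y → ℝ}
    (hW1 : ∀ x, ∑ y : Y, W x y = 1) {p : X → ℝ} (hp : IsPmf p) {q : Y → ℝ} (hq : ∀ y, 0 < q y)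
    (hq1 : ∑ y, q y = 1) (hqp : ∀ y, ∑ x, p x * W x y = q y) :
    FF (fun x _ y => W x y) (fun x y => p x * q y)
      = ∑ x, p x * (∑ y, W x y * Real.log (W x y / q y)) := by
  rw [FF_W hW1 hq (fun x y => mul_nonneg (hp.1 x) (hq y).le)]
  have : ∀ y' y, ∑ x, p x * q y' * W x y = q y * q y' := by
    intro y' y
    rw [← hqp y, Finset.sum_mul]
    exact Finset.sum_congr rfl fun x _ => by ring
  simp only [this, ← Finset.sum_mul, ← Finset.mul_sum, hp.2, hq1, one_mul, mul_one, sub_self,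
    Finset.sum_const_zero, sub_zero]

/-- Two maximizers with positive outputs, supported on `S`, agree. -/
lemma max_unique {X Y : Type*} [Fintype X] [Fintype Y] [Nonempty Y] {S : Finset X}
    {Q : X → Y → Y → ℝ} (hQ : IsPOST Q)
    (hinj : ∀ y', ∀ c c' : X → ℝ, (∀ x ∉ S, c x = 0) → (∀ x ∉ S, c' x = 0) →
          (∀ y, ∑ x, c x * Q x y' y = ∑ x, c' x * Q x y' y) → c = c')
    {P₁ P₂ : X → Y → ℝ} (h₁ : IsFbMaximizer Q P₁) (h₂ : IsFbMaximizer Q P₂)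
    (r₁ : ∀ y' y, 0 < ∑ x, P₁ x y' * Q x y' y) (r₂ : ∀ y' y, 0 < ∑ x, P₂ x y' * Q x y' y)
    (s₁ : ∀ x ∉ S, ∀ y, P₁ x y = 0) (s₂ : ∀ x ∉ S, ∀ y, P₂ x y = 0) : P₁ = P₂ := by
  obtain ⟨hj1, hs1, hm1⟩ := h₁
  obtain ⟨hj2, hs2, hm2⟩ := h₂
  set M : X → Y → ℝ := fun x y => (P₁ x y + P₂ x y) / 2 with hM
  have sumR : ∀ (P : X → Y → ℝ) y', ∑ y, ∑ x, P x y' * Q x y' y = ∑ x, P x y' := by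
    intro P y'
    rw [Finset.sum_comm]
    simp only [← Finset.mul_sum, hQ.2, mul_one]
  have hrM : ∀ y' y, ∑ x, M x y' * Q x y' y
      = ((∑ x, P₁ x y' * Q x y' y) + ∑ x, P₂ x y' * Q x y' y) / 2 := by
    intro y' y
    rw [← Finset.sum_add_distrib, Finset.sum_div]
    exact Finset.sum_congr rfl fun x _ => by rw [hM]; ring
  have hpM : ∀ y', ∑ x, M x y' = ((∑ x, P₁ x y') + ∑ x, P₂ x y') / 2 := by
    intro y'
    rw [← Finset.sum_add_distrib, Finset.sum_div]
  have hjM : IsJointPmf M := by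
    refine ⟨fun x y => by have := hj1.1 x y; have := hj2.1 x y; simp only [hM]; linarith, ?_⟩
    have a := hj1.2
    have b := hj2.2
    rw [Finset.sum_comm] at a b ⊢
    simp only [hpM, ← Finset.sum_div, Finset.sum_add_distrib, a, b]; norm_num
  have hsM : StationaryFor Q M := by
    intro y
    have a := hs1 y
    have b := hs2 y
    rw [Finset.sum_comm] at a b ⊢
    rw [hpM, ← a, ← b]
    simp only [hrM, ← Finset.sum_div, Finset.sum_add_distrib]
  have hle := hm1 M hjM hsM
  have h12 := hm1 P₂ hj2 hs2
  have h21 := hm2 P₁ hj1 hs1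
  rw [fbMI_eq hQ hjM.1, fbMI_eq hQ hj1.1] at hle
  rw [fbMI_eq hQ hj1.1, fbMI_eq hQ hj2.1] at h12 h21
  have pos1 : ∀ y', 0 < ∑ x, P₁ x y' := fun y' => by
    rw [← sumR]; exact Finset.sum_pos (fun y _ => r₁ y' y) Finset.univ_nonempty
  have pos2 : ∀ y', 0 < ∑ x, P₂ x y' := fun y' => by
    rw [← sumR]; exact Finset.sum_pos (fun y _ => r₂ y' y) Finset.univ_nonempty
  have posM : ∀ y', 0 < ∑ x, M x y' := fun y' => by
    rw [hpM]; have := pos1 y'; have := pos2 y'; linarith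
  have rM : ∀ y' y, 0 < ∑ x, M x y' * Q x y' y := fun y' y => by
    rw [hrM]; have := r₁ y' y; have := r₂ y' y; linarith
  have hFF : ∀ P : X → Y → ℝ, FF Q P =
      ∑ x : X, ∑ y' : Y, P x y' * ∑ y : Y, Q x y' y * Real.log (Q x y' y)
      - ∑ y', ∑ y, (∑ x, P x y' * Q x y' y) *
        (Real.log (∑ x, P x y' * Q x y' y) - Real.log (∑ x, P x y')) := by
    intro P
    unfold FF
    simp only [mul_sub, Finset.sum_sub_distrib]
    simp only [← Finset.sum_mul, sumR]
    ring
  rw [hFF, hFF] at hle h12 h21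
  have hlin : ∑ x : X, ∑ y' : Y, M x y' * ∑ y : Y, Q x y' y * Real.log (Q x y' y)
      = (∑ x : X, ∑ y' : Y, P₁ x y' * ∑ y : Y, Q x y' y * Real.log (Q x y' y)
        + ∑ x : X, ∑ y' : Y, P₂ x y' * ∑ y : Y, Q x y' y * Real.log (Q x y' y)) / 2 := by
    simp only [← Finset.sum_add_distrib, Finset.sum_div]
    exact Finset.sum_congr rfl fun x _ => Finset.sum_congr rfl fun y _ => by rw [hM]; ring
  set K : Y → Y → ℝ := fun y' y => (∑ x, M x y' * Q x y' y) / ∑ x, M x y' with hK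
  have Kpos : ∀ a b, 0 < K a b := fun a b => div_pos (rM a b) (posM a)
  have Ksum : ∀ a, ∑ b, K a b = 1 := fun a => by
    simp only [hK]; rw [← Finset.sum_div, sumR, div_self (posM a).ne']
  have gen : ∀ P : X → Y → ℝ, (∀ y' y, 0 < ∑ x, P x y' * Q x y' y) → (∀ y', 0 < ∑ x, P x y') →
      ∃ T : Y → Y → ℝ, (∀ y' y, 0 ≤ T y' y) ∧
        (∀ y' y, T y' y = 0 → ∑ x, P x y' * Q x y' y = (∑ x, P x y') * K y' y) ∧
        ∑ y', ∑ y, T y' y = ∑ y', ∑ y, (∑ x, P x y' * Q x y' y) *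
          (Real.log (∑ x, P x y' * Q x y' y) - Real.log (∑ x, P x y'))
          - ∑ y', ∑ y, (∑ x, P x y' * Q x y' y) * Real.log (K y' y) := by
    intro P hr hp
    have hs : ∀ y' y, 0 < (∑ x, P x y') * K y' y := fun y' y => mul_pos (hp y') (Kpos y' y)
    refine ⟨fun y' y => (∑ x, P x y' * Q x y' y) * Real.log (∑ x, P x y' * Q x y' y)
      - (∑ x, P x y' * Q x y' y) * Real.log ((∑ x, P x y') * K y' y)
      - ((∑ x, P x y' * Q x y' y) - (∑ x, P x y') * K y' y), ?_, ?_, ?_⟩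
    · intro y' y
      exact sub_nonneg.2 (kl_ge (hr y' y).le (hs y' y).le (fun h => absurd h (hs y' y).ne'))
    · intro y' y h
      exact kl_eq (hr y' y).le (hs y' y).le (fun h => absurd h (hs y' y).ne') (sub_eq_zero.1 h).le
    · simp only [Real.log_mul (hp _).ne' (Kpos _ _).ne', Finset.sum_sub_distrib, mul_sub, mul_add,
        Finset.sum_add_distrib, ← Finset.mul_sum, Ksum, sumR]
      ring
  obtain ⟨T1, T1n, T1z, T1s⟩ := gen P₁ r₁ pos1
  obtain ⟨T2, T2n, T2z, T2s⟩ := gen P₂ r₂ pos2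
  have hMK : ∑ y', ∑ y, (∑ x, M x y' * Q x y' y) *
        (Real.log (∑ x, M x y' * Q x y' y) - Real.log (∑ x, M x y'))
      = (∑ y', ∑ y, (∑ x, P₁ x y' * Q x y' y) * Real.log (K y' y)
        + ∑ y', ∑ y, (∑ x, P₂ x y' * Q x y' y) * Real.log (K y' y)) / 2 := by
    simp only [← Finset.sum_add_distrib, Finset.sum_div]
    refine Finset.sum_congr rfl fun y' _ => Finset.sum_congr rfl fun y _ => ?_
    rw [← Real.log_div (rM y' y).ne' (posM y').ne', hrM y' y]
    simp only [hK, hrM]; ring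
  have n1 := Finset.sum_nonneg (s := Finset.univ) fun y' _ =>
    Finset.sum_nonneg (s := Finset.univ) fun y _ => T1n y' y
  have n2 := Finset.sum_nonneg (s := Finset.univ) fun y' _ =>
    Finset.sum_nonneg (s := Finset.univ) fun y _ => T2n y' y
  rw [hlin, hMK] at hle
  have z1 : ∑ y', ∑ y, T1 y' y = 0 := by linarith
  have z2 : ∑ y', ∑ y, T2 y' y = 0 := by linarith
  have zz : ∀ T : Y → Y → ℝ, (∀ y' y, 0 ≤ T y' y) → ∑ y', ∑ y, T y' y = 0 →
      ∀ y' y, T y' y = 0 := by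
    intro T hT h y' y
    rw [Finset.sum_eq_zero_iff_of_nonneg
      (fun y' _ => Finset.sum_nonneg fun y _ => hT y' y)] at h
    have h := h y' (Finset.mem_univ _)
    rw [Finset.sum_eq_zero_iff_of_nonneg (fun y _ => hT y' y)] at h
    exact h y (Finset.mem_univ _)
  have k1 := fun y' y => T1z y' y (zz T1 T1n z1 y' y)
  have k2 := fun y' y => T2z y' y (zz T2 T2n z2 y' y)
  have hp : (fun y => ∑ x, P₁ x y) = (fun y => ∑ x, P₂ x y) := by
    refine stat_unique (K := K) pos2 ?_ ?_ Kpos ?_ ?_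
    · rw [Finset.sum_comm]; exact hj1.2
    · rw [Finset.sum_comm]; exact hj2.2
    · intro y; rw [← hs1 y, Finset.sum_comm]; simp only [k1]
    · intro y; rw [← hs2 y, Finset.sum_comm]; simp only [k2]
  funext x y'
  refine congrFun (hinj y' (fun x => P₁ x y') (fun x => P₂ x y') (fun x hx => s₁ x hx y')
    (fun x hx => s₂ x hx y') fun y => ?_) x
  rw [k1, k2]
  rw [show ∑ x, P₁ x y' = ∑ x, P₂ x y' from congrFun hp y']

lemma isCompact_pmf {X Y : Type*} [Fintype X] [Fintype Y] :
    IsCompact {P : X → Y → ℝ | IsJointPmf P} := by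
  refine IsCompact.of_isClosed_subset (isCompact_Icc (a := fun _ _ => (0:ℝ)) (b := fun _ _ => 1)) ?_ ?_
  · have : {P : X → Y → ℝ | IsJointPmf P} =
        (⋂ x, ⋂ y, {P : X → Y → ℝ | 0 ≤ P x y}) ∩ {P | ∑ x, ∑ y, P x y = 1} := by
      ext P; simp [IsJointPmf]
    rw [this]
    refine IsClosed.inter (isClosed_iInter fun x => isClosed_iInter fun y =>
      isClosed_le (by fun_prop) (by fun_prop)) (isClosed_eq (by fun_prop) (by fun_prop))
  · intro P hP
    refine ⟨fun x y => hP.1 x y, fun x y => ?_⟩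
    show P x y ≤ 1
    rw [← hP.2]
    calc P x y ≤ ∑ y, P x y :=
          Finset.single_le_sum (f := fun y => P x y) (fun y _ => hP.1 x y) (Finset.mem_univ y)
      _ ≤ _ := Finset.single_le_sum (f := fun x => ∑ y, P x y)
          (fun x _ => Finset.sum_nonneg fun y _ => hP.1 x y) (Finset.mem_univ x)

lemma isClosed_stat {X Y : Type*} [Fintype X] [Fintype Y] (Q : X → Y → Y → ℝ) :
    IsClosed {P : X → Y → ℝ | StationaryFor Q P} := by
  have : {P : X → Y → ℝ | StationaryFor Q P} =
      ⋂ y, {P | ∑ x : X, ∑ y' : Y, P x y' * Q x y' y = ∑ x : X, P x y} := by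
    ext P; simp [StationaryFor]
  rw [this]
  exact isClosed_iInter fun y => isClosed_eq (by fun_prop) (by fun_prop)

lemma exists_max {X Y : Type*} [Fintype X] [Fintype Y] {Q : X → Y → Y → ℝ} (hQ : IsPOST Q)
    {P₀ : X → Y → ℝ} (h1 : IsJointPmf P₀) (h2 : StationaryFor Q P₀) :
    ∃ P, IsFbMaximizer Q P := by
  have hK : IsCompact ({P : X → Y → ℝ | IsJointPmf P} ∩ {P | StationaryFor Q P}) :=
    isCompact_pmf.inter_right (isClosed_stat Q)
  have hc : Continuous (fun P : X → Y → ℝ => FF Q P) :=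
    continuous_FF.comp (Continuous.prodMk_right Q)
  obtain ⟨P, hP, hm⟩ := hK.exists_isMaxOn ⟨P₀, h1, h2⟩ hc.continuousOn
  refine ⟨P, hP.1, hP.2, fun P' a b => ?_⟩
  rw [fbMI_eq hQ a.1, fbMI_eq hQ hP.1.1]
  exact hm ⟨a, b⟩

/-- If redistributing the mass at `(x₀,y₀)` onto `S` increases the linear part of the objective,
a maximizer positive on `S` has no mass at `(x₀,y₀)`. -/
lemma no_mass {X Y : Type*} [Fintype X] [Fintype Y] [DecidableEq X] [DecidableEq Y]
    {S : Finset X} {Q : X → Y → Y → ℝ} (hQ : IsPOST Q) {P : X → Y → ℝ} (hP : IsFbMaximizer Q P)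
    (hpos : ∀ x ∈ S, ∀ y, 0 < P x y) {x₀ : X} {y₀ : Y} {a : X → ℝ}
    (haS : ∀ x ∉ S, a x = 0) (ha : ∀ y, ∑ x, a x * Q x y₀ y = Q x₀ y₀ y)
    (hgain : ∑ y, Q x₀ y₀ y * Real.log (Q x₀ y₀ y)
      < ∑ x, a x * ∑ y, Q x y₀ y * Real.log (Q x y₀ y)) : P x₀ y₀ = 0 := by
  obtain ⟨hj, hs, hm⟩ := hP
  by_contra hne
  have h0 : 0 < P x₀ y₀ := lt_of_le_of_ne (hj.1 _ _) (Ne.symm hne)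
  have hev : ∀ᶠ t in 𝓝[>] (0:ℝ), 0 < t ∧ t < P x₀ y₀ / 2 ∧
      ∀ x, x ∈ S → 0 < P x y₀ / 2 + t * a x := by
    refine (eventually_nhdsWithin_of_forall fun t ht => ht).and
      ((eventually_nhdsWithin_of_eventually_nhds (eventually_lt_nhds (by linarith))).and ?_)
    rw [eventually_all]
    intro x
    by_cases hx : x ∈ S
    · have hc : ContinuousAt (fun t : ℝ => P x y₀ / 2 + t * a x) 0 := by fun_prop
      have := hc.eventually (lt_mem_nhds (a := 0) (by have := hpos x hx y₀; simp; linarith))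
      exact (eventually_nhdsWithin_of_eventually_nhds this).mono fun t ht _ => ht
    · exact Eventually.of_forall fun t h => absurd h hx
  obtain ⟨t, ht, ht2, htS⟩ := hev.exists
  set b : X → ℝ := fun x => a x - if x = x₀ then 1 else 0 with hb
  have hbs : ∀ f : X → ℝ, ∑ x, b x * f x = ∑ x, a x * f x - f x₀ := by
    intro f; simp [hb, sub_mul, Finset.sum_sub_distrib]
  have hbQ : ∀ y, ∑ x, b x * Q x y₀ y = 0 := fun y => by rw [hbs, ha, sub_self]
  have hb0 : ∑ x, b x = 0 := by
    have h : ∑ y, ∑ x, b x * Q x y₀ y = 0 := Finset.sum_eq_zero fun y _ => hbQ y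
    rw [Finset.sum_comm] at h
    simpa only [← Finset.mul_sum, hQ.2, mul_one] using h
  set P' : X → Y → ℝ := fun x y => P x y + if y = y₀ then t * b x else 0 with hP'
  have hr : ∀ y' y, ∑ x, P' x y' * Q x y' y = ∑ x, P x y' * Q x y' y := by
    intro y' y
    by_cases h : y' = y₀
    · subst h
      simp only [hP', if_true, add_mul, Finset.sum_add_distrib, mul_assoc, ← Finset.mul_sum, hbQ,
        mul_zero, add_zero]
    · simp [hP', h]
  have hp : ∀ y', ∑ x, P' x y' = ∑ x, P x y' := by
    intro y'
    by_cases h : y' = y₀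
    · subst h
      simp only [hP', if_true, Finset.sum_add_distrib, ← Finset.mul_sum, hb0,
        mul_zero, add_zero]
    · simp [hP', h]
  have hj' : IsJointPmf P' := by
    refine ⟨fun x y => ?_, ?_⟩
    · by_cases h : y = y₀
      · subst h
        simp only [hP', hb, if_true]
        have hPx := hj.1 x y
        by_cases hx : x ∈ S
        · have := htS x hx
          split_ifs with hxx
          · subst hxx; linarith
          · linarith
        · rw [haS x hx]
          split_ifs with hxx
          · subst hxx; linarith
          · linarith
      · simpa [hP', h] using hj.1 x y
    · rw [Finset.sum_comm]; simp only [hp]; rw [Finset.sum_comm]; exact hj.2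
  have hs' : StationaryFor Q P' := by
    intro y
    rw [hp, ← hs y, Finset.sum_comm]; simp only [hr]; rw [Finset.sum_comm]
  have hle := hm P' hj' hs'
  rw [fbMI_eq hQ hj'.1, fbMI_eq hQ hj.1] at hle
  unfold FF at hle
  simp only [hr, hp] at hle
  have hlin : ∑ x : X, ∑ y' : Y, P' x y' * ∑ y : Y, Q x y' y * Real.log (Q x y' y)
      = ∑ x : X, ∑ y' : Y, P x y' * ∑ y : Y, Q x y' y * Real.log (Q x y' y)
        + t * (∑ x, b x * ∑ y, Q x y₀ y * Real.log (Q x y₀ y)) := by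
    simp only [hP', add_mul, Finset.sum_add_distrib, ite_mul, zero_mul, Finset.sum_ite_eq',
      Finset.mem_univ, if_true, mul_assoc, ← Finset.mul_sum]
  rw [hlin, hbs] at hle
  have := mul_pos ht (sub_pos.2 hgain)
  linarith

end RMP

open Filter Topology RMP

set_option maxHeartbeats 2000000

/-- For a memoryless surjective channel `W` with distinguished set
`S ⊆ 𝒳`, `|S| = |𝒴|`: for small enough `δ`, every `W`-centered `δ`-approximately
memoryless POST channel `Q` has a unique maximizer of the problem defining `C*_f(Q)`,
whose `X`-marginal is supported on `S`; moreover the maximizers converge uniformly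
to `P_X^W ⊗ P_Y^W` as `δ → 0`. -/
theorem refined_maximizer_properties
    {X Y : Type*} [Fintype X] [Fintype Y] [DecidableEq X] [DecidableEq Y]
    (hX : 2 ≤ Fintype.card X) (hY : 2 ≤ Fintype.card Y)
    (W : X → Y → ℝ) (hW0 : ∀ x y, 0 ≤ W x y) (hW1 : ∀ x, ∑ y : Y, W x y = 1)
    -- `pX` is a capacity-achieving input distribution of `W`
    (pX : X → ℝ) (hpX : IsPmf pX)
    (hpXopt : ∀ p : X → ℝ, IsPmf p → mlMI W p ≤ mlMI W pX)
    -- surjectivity of `W`, witnessed by `S ⊆ 𝒳` with `|S| = |𝒴|`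
    (S : Finset X) (hScard : S.card = Fintype.card Y)
    (hSpos : ∀ x ∈ S, 0 < pX x)
    (hSeq : ∀ x ∈ S,
      ∑ y : Y, W x y * Real.log (W x y / ∑ x' : X, pX x' * W x' y) = mlMI W pX)
    (hSlt : ∀ x ∉ S,
      ∑ y : Y, W x y * Real.log (W x y / ∑ x' : X, pX x' * W x' y) < mlMI W pX)
    (hSrank : LinearIndependent ℝ (fun x : S => W x.val)) :
    (∃ δ > (0 : ℝ), ∀ Q : X → Y → Y → ℝ, IsPOST Q →
      (∀ x y' y, |Q x y' y - W x y| ≤ δ) →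
        (∃! P : X → Y → ℝ, IsFbMaximizer Q P) ∧
        ∀ P : X → Y → ℝ, IsFbMaximizer Q P → ∀ x ∉ S, ∑ y : Y, P x y = 0) ∧
    ∀ ε > (0 : ℝ), ∃ δ > (0 : ℝ), ∀ Q : X → Y → Y → ℝ, IsPOST Q →
      (∀ x y' y, |Q x y' y - W x y| ≤ δ) →
      ∀ P : X → Y → ℝ, IsFbMaximizer Q P →
        ∀ x y, |P x y - pX x * ∑ x' : X, pX x' * W x' y| ≤ ε := by
  classical
  have : Nonempty Y := Fintype.card_pos_iff.1 (by omega)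
  obtain ⟨sol, hsol, hsolS, hsolc⟩ := solve W S hScard hSrank
  have hsolW := hsol.self_of_nhds
  set q : Y → ℝ := fun y => ∑ x', pX x' * W x' y with hqdef
  have hSeq' : ∀ x ∈ S, ∑ y : Y, W x y * Real.log (W x y / q y) = mlMI W pX := hSeq
  have hSlt' : ∀ x ∉ S, ∑ y : Y, W x y * Real.log (W x y / q y) < mlMI W pX := hSlt
  have hq : ∀ y, 0 < q y := by
    intro y
    have hn : ∀ x ∈ Finset.univ, 0 ≤ pX x * W x y := fun x _ => mul_nonneg (hpX.1 x) (hW0 x y)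
    refine lt_of_le_of_ne (Finset.sum_nonneg hn) fun h => ?_
    have h' := (Finset.sum_eq_zero_iff_of_nonneg hn).1 h.symm
    have h1 := hsolW.1 (fun _ => 1) y
    rw [Finset.sum_eq_zero] at h1
    · exact zero_ne_one h1
    · intro x hx
      by_cases hxS : x ∈ S
      · rw [(mul_eq_zero.1 (h' x hx)).resolve_left (hSpos x hxS).ne', mul_zero]
      · rw [hsolS _ _ x hxS, zero_mul]
  have hq1 : ∑ y, q y = 1 := by
    simp only [hqdef]; rw [Finset.sum_comm]
    simp only [← Finset.mul_sum, hW1, mul_one]; exact hpX.2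
  have hCsum : ∑ x, pX x * (∑ y, W x y * Real.log (W x y / q y)) = mlMI W pX := by
    unfold mlMI
    simp only [Finset.mul_sum, mul_assoc, hqdef]
  have hpXS : ∀ x ∉ S, pX x = 0 := by
    have hnn : ∀ x ∈ Finset.univ,
        0 ≤ pX x * (mlMI W pX - ∑ y, W x y * Real.log (W x y / q y)) := by
      intro x _
      refine mul_nonneg (hpX.1 x) (sub_nonneg.2 ?_)
      by_cases h : x ∈ S
      · exact (hSeq' x h).le
      · exact (hSlt' x h).le
    have hz : ∑ x, pX x * (mlMI W pX - ∑ y, W x y * Real.log (W x y / q y)) = 0 := by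
      simp only [mul_sub, Finset.sum_sub_distrib]
      rw [hCsum, ← Finset.sum_mul, hpX.2, one_mul, sub_self]
    intro x hx
    have := (Finset.sum_eq_zero_iff_of_nonneg hnn).1 hz x (Finset.mem_univ x)
    exact (mul_eq_zero.1 this).resolve_right (sub_pos.2 (hSlt' x hx)).ne'
  set Wt : X → Y → Y → ℝ := fun x _ y => W x y with hWt
  set P0 : X → Y → ℝ := fun x y => pX x * q y with hP0
  -- slices
  have hslice : ∀ y', Tendsto (fun Q : X → Y → Y → ℝ => fun x y => Q x y' y) (𝓝 Wt) (𝓝 W) := by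
    intro y'
    have : Continuous (fun Q : X → Y → Y → ℝ => fun x y => Q x y' y) := by fun_prop
    exact this.tendsto Wt
  have hsolQ := eventually_all.2 fun y' => (hslice y').eventually hsol
  -- the reference feasible point
  set PQ : (X → Y → Y → ℝ) → X → Y → ℝ :=
    fun Q x y' => sol (fun x y => Q x y' y) q x * q y' with hPQ
  have hPQc : ContinuousAt PQ Wt := by
    refine continuousAt_pi.2 fun x => continuousAt_pi.2 fun y' => ?_
    refine ContinuousAt.mul ?_ continuousAt_const
    exact Tendsto.comp (hsolc q x) ((hslice y').prodMk_nhds tendsto_const_nhds)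
  have hPQW : PQ Wt = P0 := by
    have : sol W q = pX := hsolW.2 _ _ (hsolS W q) hpXS (fun y => hsolW.1 q y)
    funext x y'
    simp only [hPQ, hWt, hP0, this]
  have hPQn : ∀ᶠ Q in 𝓝 Wt, ∀ x y, 0 ≤ PQ Q x y := by
    refine eventually_all.2 fun x => eventually_all.2 fun y => ?_
    by_cases hx : x ∈ S
    · have hc : ContinuousAt (fun Q => PQ Q x y) Wt := continuousAt_pi.1 (continuousAt_pi.1 hPQc x) y
      refine (hc.eventually (lt_mem_nhds (a := 0) ?_)).mono fun _ h => h.le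
      show 0 < PQ Wt x y
      rw [hPQW]; exact mul_pos (hSpos x hx) (hq y)
    · exact Eventually.of_forall fun Q => by simp only [hPQ, hsolS _ _ x hx, zero_mul, le_refl]
  have hfeas : ∀ᶠ Q in 𝓝 Wt, IsPOST Q → IsJointPmf (PQ Q) ∧ StationaryFor Q (PQ Q) := by
    filter_upwards [hPQn, hsolQ] with Q hn hs hQ
    have hr : ∀ y' y, ∑ x, PQ Q x y' * Q x y' y = q y * q y' := by
      intro y' y
      rw [← (hs y').1 q y, Finset.sum_mul]
      exact Finset.sum_congr rfl fun x _ => by simp only [hPQ]; ring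
    have hp : ∀ y', ∑ x, PQ Q x y' = q y' := by
      intro y'
      have : ∑ y, ∑ x, PQ Q x y' * Q x y' y = q y' := by
        simp only [hr, ← Finset.sum_mul, hq1, one_mul]
      rw [Finset.sum_comm] at this
      simpa only [← Finset.mul_sum, hQ.2, mul_one] using this
    refine ⟨⟨hn, ?_⟩, fun y => ?_⟩
    · rw [Finset.sum_comm]; simp only [hp, hq1]
    · rw [Finset.sum_comm]; simp only [hr, hp, ← Finset.mul_sum, hq1, mul_one]
  -- convergence of maximizers
  have hconv : ∀ ε > (0:ℝ), ∀ᶠ Q in 𝓝 Wt, IsPOST Q → ∀ P, IsFbMaximizer Q P →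
      ∀ x y, |P x y - P0 x y| < ε := by
    intro ε hε
    have hK := (isCompact_pmf (X := X) (Y := Y)).eventually_forall_of_forall_eventually
      (x₀ := Wt) (P := fun Q P => StationaryFor Q P → FF Q (PQ Q) ≤ FF Q P →
        ∀ x y, |P x y - P0 x y| < ε) ?_
    · filter_upwards [hK, hfeas] with Q h1 h2 hQ P hP
      have hf := h2 hQ
      have hle := hP.2.2 _ hf.1 hf.2
      rw [fbMI_eq hQ hf.1.1, fbMI_eq hQ hP.1.1] at hle
      exact h1 P hP.1 hP.2.1 hle
    · intro P hP
      by_cases hst : StationaryFor Wt P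
      · by_cases hC : FF Wt P0 ≤ FF Wt P
        · have hC' : mlMI W pX ≤ FF Wt P := by
            rw [← hCsum, ← FF_W_opt hW1 hpX hq hq1 (fun y => rfl)]; exact hC
          obtain ⟨a, b⟩ := W_char hW0 hW1 hq hq1 hSeq' hSlt' hP hst hC'
          have hPP : P = P0 := by
            funext x y'
            refine congrFun (hsolW.2 (fun x => P x y') (fun x => P0 x y') (fun x hx => a x hx y')
              (fun x hx => by simp only [hP0, hpXS x hx, zero_mul]) fun y => ?_) x
            rw [b y' y]
            simp only [hP0]
            have : q y = ∑ x, pX x * W x y := rfl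
            rw [this, Finset.sum_mul]
            exact Finset.sum_congr rfl fun x _ => by ring
          have : ∀ᶠ z : (X → Y → Y → ℝ) × (X → Y → ℝ) in 𝓝 (Wt, P),
              ∀ x y, |z.2 x y - P0 x y| < ε := by
            refine eventually_all.2 fun x => eventually_all.2 fun y => ?_
            have hc : Continuous (fun z : (X → Y → Y → ℝ) × (X → Y → ℝ) =>
              |z.2 x y - P0 x y|) := by fun_prop
            refine hc.continuousAt.eventually (gt_mem_nhds ?_)
            simpa [hPP] using hε
          exact this.mono fun z hz _ _ => hz
        · push Not at hC
          have hc1 : ContinuousAt (fun z : (X → Y → Y → ℝ) × (X → Y → ℝ) => FF z.1 z.2) (Wt, P) :=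
            continuous_FF.continuousAt
          have hc2 : ContinuousAt (fun z : (X → Y → Y → ℝ) × (X → Y → ℝ) =>
              FF z.1 (PQ z.1)) (Wt, P) := cont_FF_ref hPQc P
          have := hc1.eventually_lt hc2 (by simpa only [hPQW] using hC)
          exact this.mono fun z hz _ h => absurd h (not_le.2 hz)
      · unfold StationaryFor at hst
        push Not at hst
        obtain ⟨y, hy⟩ := hst
        have hc1 : Continuous (fun z : (X → Y → Y → ℝ) × (X → Y → ℝ) =>
          ∑ x : X, ∑ y' : Y, z.2 x y' * z.1 x y' y - ∑ x : X, z.2 x y) := by fun_prop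
        have := (hc1.continuousAt (x := (Wt, P))).eventually_ne (sub_ne_zero.2 hy)
        exact this.mono fun z hz h => absurd (sub_eq_zero.2 (h y)) hz
  have hposS : ∀ᶠ Q in 𝓝 Wt, IsPOST Q → ∀ P, IsFbMaximizer Q P → ∀ x ∈ S, ∀ y, 0 < P x y := by
    have : ∀ᶠ Q in 𝓝 Wt, ∀ x y, x ∈ S → IsPOST Q → ∀ P, IsFbMaximizer Q P → 0 < P x y := by
      refine eventually_all.2 fun x => eventually_all.2 fun y => ?_
      by_cases hx : x ∈ S
      · filter_upwards [hconv (P0 x y) (mul_pos (hSpos x hx) (hq y))] with Q h _ hQ P hP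
        have := (abs_lt.1 (h hQ P hP x y)).1
        linarith
      · exact Eventually.of_forall fun Q h => absurd h hx
    exact this.mono fun Q h hQ P hP x hx y => h x y hx hQ P hP
  have hlog := Real.continuous_mul_log
  have hgain : ∀ᶠ Q in 𝓝 Wt, ∀ x₀ y₀, x₀ ∉ S →
      ∑ y, Q x₀ y₀ y * Real.log (Q x₀ y₀ y)
      < ∑ x, sol (fun x y => Q x y₀ y) (Q x₀ y₀) x * ∑ y, Q x y₀ y * Real.log (Q x y₀ y) := by
    refine eventually_all.2 fun x₀ => eventually_all.2 fun y₀ => ?_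
    by_cases hx : x₀ ∈ S
    · exact Eventually.of_forall fun Q h => absurd hx h
    have hh : ∀ x, Continuous (fun Q : X → Y → Y → ℝ => ∑ y, Q x y₀ y * Real.log (Q x y₀ y)) := by
      intro x
      refine continuous_finsetSum _ fun y _ => ?_
      exact hlog.comp (by fun_prop : Continuous (fun Q : X → Y → Y → ℝ => Q x y₀ y))
    have hev : Tendsto (fun Q : X → Y → Y → ℝ => Q x₀ y₀) (𝓝 Wt) (𝓝 (W x₀)) :=
      (by fun_prop : Continuous (fun Q : X → Y → Y → ℝ => Q x₀ y₀)).tendsto Wt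
    have hc : ContinuousAt (fun Q : X → Y → Y → ℝ =>
        ∑ x, sol (fun x y => Q x y₀ y) (Q x₀ y₀) x * ∑ y, Q x y₀ y * Real.log (Q x y₀ y)) Wt := by
      refine tendsto_finsetSum _ fun x _ => ?_
      refine Tendsto.mul ?_ ((hh x).tendsto Wt)
      exact Tendsto.comp (hsolc (W x₀) x) ((hslice y₀).prodMk_nhds hev)
    refine ((hh x₀).continuousAt.eventually_lt hc ?_).mono fun Q h _ => h
    simp only [hWt]
    have ha := hsolW.1 (W x₀)
    set a := sol W (W x₀) with hadef
    have haS : ∀ x ∉ S, a x = 0 := hsolS W (W x₀)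
    have hD : ∀ x, ∑ y, W x y * Real.log (W x y)
        = ∑ y, W x y * Real.log (W x y / q y) + ∑ y, W x y * Real.log (q y) := by
      intro x
      rw [← Finset.sum_add_distrib]
      refine Finset.sum_congr rfl fun y _ => ?_
      by_cases h : W x y = 0
      · simp [h]
      · rw [Real.log_div h (hq y).ne']; ring
    have ha1 : ∑ x, a x = 1 := by
      have : ∑ y, ∑ x, a x * W x y = 1 := by simp only [ha, hW1]
      rw [Finset.sum_comm] at this
      simpa only [← Finset.mul_sum, hW1, mul_one] using this
    have e1 : ∑ x, a x * ∑ y, W x y * Real.log (W x y / q y) = mlMI W pX := by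
      have : ∀ x, a x * ∑ y, W x y * Real.log (W x y / q y) = a x * mlMI W pX := by
        intro x
        by_cases h : x ∈ S
        · rw [hSeq' x h]
        · rw [haS x h, zero_mul, zero_mul]
      simp only [this, ← Finset.sum_mul, ha1, one_mul]
    have e2 : ∑ x, a x * ∑ y, W x y * Real.log (q y) = ∑ y, W x₀ y * Real.log (q y) := by
      simp only [Finset.mul_sum]
      rw [Finset.sum_comm]
      simp only [← mul_assoc, ← Finset.sum_mul, ha]
    simp only [hD, mul_add, Finset.sum_add_distrib]
    rw [e1, e2]
    have := hSlt' x₀ hx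
    linarith
  have hmain : ∀ᶠ Q in 𝓝 Wt, IsPOST Q → (∃! P : X → Y → ℝ, IsFbMaximizer Q P) ∧
        ∀ P : X → Y → ℝ, IsFbMaximizer Q P → ∀ x ∉ S, ∑ y : Y, P x y = 0 := by
    filter_upwards [hfeas, hposS, hgain, hsolQ] with Q h1 h2 h3 h4 hQ
    have hsupp : ∀ P : X → Y → ℝ, IsFbMaximizer Q P → ∀ x ∉ S, ∀ y, P x y = 0 := by
      intro P hP x hx y
      exact no_mass hQ hP (h2 hQ P hP) (hsolS _ _) (fun y' => (h4 y).1 (Q x y) y') (h3 x y hx)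
    have hrpos : ∀ P : X → Y → ℝ, IsFbMaximizer Q P → ∀ y' y, 0 < ∑ x, P x y' * Q x y' y := by
      intro P hP y' y
      have hn : ∀ x ∈ Finset.univ, 0 ≤ P x y' * Q x y' y :=
        fun x _ => mul_nonneg (hP.1.1 x y') (hQ.1 _ _ _)
      refine lt_of_le_of_ne (Finset.sum_nonneg hn) fun h => ?_
      have h' := (Finset.sum_eq_zero_iff_of_nonneg hn).1 h.symm
      have h5 := (h4 y').1 (fun _ => 1) y
      rw [Finset.sum_eq_zero] at h5
      · exact zero_ne_one h5
      · intro x hx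
        by_cases hxS : x ∈ S
        · rw [(mul_eq_zero.1 (h' x hx)).resolve_left (h2 hQ P hP x hxS y').ne', mul_zero]
        · rw [hsolS _ _ x hxS, zero_mul]
    refine ⟨?_, fun P hP x hx => Finset.sum_eq_zero fun y _ => hsupp P hP x hx y⟩
    obtain ⟨P, hP⟩ := exists_max hQ (h1 hQ).1 (h1 hQ).2
    refine ⟨P, hP, fun P' hP' => ?_⟩
    exact max_unique hQ (fun y' => (h4 y').2) hP' hP (hrpos P' hP') (hrpos P hP)
      (hsupp P' hP') (hsupp P hP)
  have toδ : ∀ p : (X → Y → Y → ℝ) → Prop, (∀ᶠ Q in 𝓝 Wt, IsPOST Q → p Q) →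
      ∃ δ > (0 : ℝ), ∀ Q : X → Y → Y → ℝ, IsPOST Q →
        (∀ x y' y, |Q x y' y - W x y| ≤ δ) → p Q := by
    intro p hp
    obtain ⟨δ, hδ, h⟩ := Metric.nhds_basis_closedBall.eventually_iff.1 hp
    refine ⟨δ, hδ, fun Q hQ hd => h ?_ hQ⟩
    rw [Metric.mem_closedBall]
    refine (dist_pi_le_iff hδ.le).2 fun x => (dist_pi_le_iff hδ.le).2 fun y' =>
      (dist_pi_le_iff hδ.le).2 fun y => ?_
    rw [Real.dist_eq]
    exact hd x y' y
  refine ⟨toδ _ hmain, fun ε hε => ?_⟩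
  exact toδ _ ((hconv ε hε).mono fun Q h hQ P hP x y => (h hQ P hP x y).le)
end
end

section
/- Let Q be a POST channel, let P* be a maximizer of the optimization problem defining C*_f(Q), and let n be a positive integer. Suppose P_{X^n Y_0} is a joint pmf on 𝒳^n × 𝒴 such that, under the induced law P_{X^n Y^n Y_0}(x^n,y^n,y_0) = P_{X^n Y_0}(x^n,y_0) ∏_{t=1}^n Q(y_t|x_t,y_{t−1}), one has P_{Y^n Y_0}(y^n,y_0) = P*_{Y′}(y_0) ∏_{t=1}^n P*_{Y|Y′}(y_t|y_{t−1}) and the marginal of (X_t, Y_{t−1}) equals P* for t = 1,…,n. Then (1/n) I(X^n;Y^n|Y_0) = C*_f(Q). -/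
open scoped BigOperators

noncomputable section

lemma prevState_cons_zero {Y : Type*} (n : ℕ) (y0 y : Y) (ys : Fin n → Y) :
    prevState (n+1) y0 (Fin.cons y ys : Fin (n+1) → Y) 0 = y0 := by
  simp [prevState]

lemma prevState_cons_succ {Y : Type*} (n : ℕ) (y0 y : Y) (ys : Fin n → Y) (t : Fin n) :
    prevState (n+1) y0 (Fin.cons y ys : Fin (n+1) → Y) t.succ = prevState n y ys t := by
  obtain ⟨t, ht⟩ := t
  cases t with
  | zero => simp [prevState]
  | succ k =>
    simp only [prevState, Fin.succ_mk, Nat.add_one_ne_zero, if_false]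
    exact Fin.cons_succ (α := fun _ => Y) y ys ⟨k, by omega⟩

lemma sum_fin_succ_fun {Y : Type*} [Fintype Y] (n : ℕ) (F : (Fin (n+1) → Y) → ℝ) :
    ∑ ys, F ys = ∑ y : Y, ∑ ys : Fin n → Y, F (Fin.cons y ys) := by
  rw [← Fintype.sum_prod_type']
  exact (Equiv.sum_comp (Fin.consEquiv (fun _ => Y)) F).symm

lemma sum_kernels {Y : Type*} [Fintype Y] (n : ℕ) (K : Fin n → Y → Y → ℝ)
    (hK : ∀ t y', ∑ y, K t y' y = 1) (y0 : Y) :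
    ∑ ys : Fin n → Y, ∏ t, K t (prevState n y0 ys t) (ys t) = 1 := by
  induction n generalizing y0 with
  | zero => simp
  | succ n ih =>
    rw [sum_fin_succ_fun]
    simp only [Fin.prod_univ_succ, prevState_cons_zero, prevState_cons_succ, Fin.cons_zero,
      Fin.cons_succ, ← Finset.mul_sum]
    simp only [ih (fun t => K t.succ) (fun t => hK t.succ), mul_one, hK]

lemma sum_kernels_fun {Y : Type*} [Fintype Y] (n : ℕ) (K : Fin n → Y → Y → ℝ)
    (hK : ∀ t y', ∑ y, K t y' y = 1) (y0 : Y) (t : Fin n) (f : Y → Y → ℝ) :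
    ∑ ys : Fin n → Y, (∏ s, K s (prevState n y0 ys s) (ys s)) * f (prevState n y0 ys t) (ys t)
    = ∑ ys : Fin n → Y, (∏ s, K s (prevState n y0 ys s) (ys s)) *
        ∑ y, K t (prevState n y0 ys t) y * f (prevState n y0 ys t) y := by
  induction n generalizing y0 with
  | zero => exact t.elim0
  | succ n ih =>
    rw [sum_fin_succ_fun, sum_fin_succ_fun]
    have hs : ∀ y, ∑ ys : Fin n → Y, ∏ s, K s.succ (prevState n y ys s) (ys s) = 1 :=
      sum_kernels n (fun t => K t.succ) (fun t => hK t.succ)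
    refine Fin.cases ?_ (fun t => ?_) t
    · simp only [Fin.prod_univ_succ, prevState_cons_zero, prevState_cons_succ, Fin.cons_zero,
        Fin.cons_succ, ← Finset.mul_sum, ← Finset.sum_mul, hs, mul_one, hK, one_mul]
    · simp only [Fin.prod_univ_succ, prevState_cons_zero, prevState_cons_succ, Fin.cons_zero,
        Fin.cons_succ, mul_assoc]
      simp only [← Finset.mul_sum]
      refine Finset.sum_congr rfl fun y _ => ?_
      congr 1
      exact ih (fun t => K t.succ) (fun t => hK t.succ) y t

/-- The single-letter information density. -/
def infoDens {X Y : Type*} [Fintype X] [Fintype Y] (Q : X → Y → Y → ℝ) (P : X → Y → ℝ)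
    (x : X) (y' y : Y) : ℝ := Real.log (Q x y' y / condOut Q P y' y)

lemma fbMI_eq {X Y : Type*} [Fintype X] [Fintype Y]
    (Q : X → Y → Y → ℝ) (hQ : IsPOST Q) (P : X → Y → ℝ) :
    fbMI Q P = ∑ x, ∑ y', P x y' * ∑ y, Q x y' y * infoDens Q P x y' y := by
  unfold fbMI condMI
  refine Finset.sum_congr rfl fun x _ => ?_
  rw [Finset.sum_comm]
  refine Finset.sum_congr rfl fun y' _ => ?_
  rw [Finset.mul_sum]
  refine Finset.sum_congr rfl fun y _ => ?_
  simp only [← Finset.mul_sum, hQ.2, mul_one]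
  by_cases h : P x y' = 0
  · simp [h]
  · rw [mul_assoc]
    congr 2
    unfold infoDens condOut
    congr 1
    rw [mul_assoc, mul_div_mul_left _ _ h, div_div_eq_mul_div]

lemma sum_rot {A B C D : Type*} [Fintype A] [Fintype B] [Fintype C] [Fintype D]
    (F : A → B → C → D → ℝ) :
    ∑ d, ∑ a, ∑ b, ∑ c, F a b c d = ∑ a, ∑ b, ∑ c, ∑ d, F a b c d := by
  rw [Finset.sum_comm]
  refine Finset.sum_congr rfl fun a _ => ?_
  rw [Finset.sum_comm]
  refine Finset.sum_congr rfl fun b _ => ?_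
  rw [Finset.sum_comm]

/-- If a joint input–initial-state pmf simulates, without feedback,
the Markov output law generated by a maximizer `P*` of the feedback problem, and its
`(X_t, Y_{t-1})` marginals all equal `P*`, then `(1/n) I(X^n;Y^n|Y_0) = C*_f(Q)`. -/
theorem simulating_input_achieves_feedback_capacity
    {X Y : Type*} [Fintype X] [Fintype Y] [DecidableEq X] [DecidableEq Y]
    (hX : 2 ≤ Fintype.card X) (hY : 2 ≤ Fintype.card Y)
    (Q : X → Y → Y → ℝ) (hQ : IsPOST Q)
    (Pstar : X → Y → ℝ) (hPstar : IsFbMaximizer Q Pstar)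
    (n : ℕ) (hn : 0 < n)
    (P : (Fin n → X) → Y → ℝ) (hP : IsJointPmfN n P)
    (hout : ∀ (ys : Fin n → Y) (y0 : Y),
      (∑ xs : Fin n → X, nLaw Q n P xs ys y0) =
        (∑ x : X, Pstar x y0) *
          ∏ t : Fin n, condOut Q Pstar (prevState n y0 ys t) (ys t))
    (hmarg : ∀ (t : Fin n) (x : X) (y' : Y),
      (∑ xs : Fin n → X, ∑ ys : Fin n → Y, ∑ y0 : Y,
          if xs t = x ∧ prevState n y0 ys t = y' then nLaw Q n P xs ys y0 else 0)
        = Pstar x y') :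
    (1 / (n : ℝ)) * condMI (nLaw Q n P) = Cfstar Q := by
  have hC : Cfstar Q = fbMI Q Pstar := by
    refine IsGreatest.csSup_eq ⟨⟨Pstar, hPstar.1, hPstar.2.1, rfl⟩, ?_⟩
    rintro r ⟨P', h1, h2, rfl⟩
    exact hPstar.2.2 P' h1 h2
  have hys : ∀ xs y0, ∑ ys, nLaw Q n P xs ys y0 = P xs y0 := by
    intro xs y0
    unfold nLaw
    rw [← Finset.mul_sum, sum_kernels n (fun t => Q (xs t)) (fun t => hQ.2 (xs t)), mul_one]
  have hW0 : ∀ xs ys y0, 0 ≤ nLaw Q n P xs ys y0 := fun xs ys y0 =>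
    mul_nonneg (hP.1 _ _) (Finset.prod_nonneg fun t _ => hQ.1 _ _ _)
  have hmargF : ∀ (t : Fin n) (h : X → Y → ℝ),
      ∑ xs, ∑ ys, ∑ y0, nLaw Q n P xs ys y0 * h (xs t) (prevState n y0 ys t)
        = ∑ x, ∑ y', Pstar x y' * h x y' := by
    intro t h
    simp only [← hmarg t, Finset.sum_mul]
    refine Eq.trans ?_ (Eq.trans (sum_rot _).symm (Finset.sum_congr rfl fun x _ => (sum_rot _).symm))
    refine Finset.sum_congr rfl fun xs _ => Finset.sum_congr rfl fun ys _ =>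
      Finset.sum_congr rfl fun y0 _ => ?_
    rw [Finset.sum_eq_single (xs t), Finset.sum_eq_single (prevState n y0 ys t)]
    · simp
    · intro b _ hb; simp [hb.symm]
    · simp
    · intro b _ hb; simp [hb.symm]
    · simp
  have hpi : ∀ y0, ∑ xs, P xs y0 = ∑ x, Pstar x y0 := by
    intro y
    have h := hmargF ⟨0, hn⟩ (fun _ y' => if y' = y then 1 else 0)
    simp only [prevState, if_true, mul_ite, mul_one, mul_zero, Finset.sum_ite_eq',
      Finset.mem_univ, hys] at h
    exact h
  have hmain : condMI (nLaw Q n P) = ∑ t : Fin n, fbMI Q Pstar := by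
    have h1 : condMI (nLaw Q n P) = ∑ xs, ∑ ys, ∑ y0, ∑ t : Fin n, nLaw Q n P xs ys y0 *
        infoDens Q Pstar (xs t) (prevState n y0 ys t) (ys t) := by
      unfold condMI
      refine Finset.sum_congr rfl fun xs _ => Finset.sum_congr rfl fun ys _ =>
        Finset.sum_congr rfl fun y0 _ => ?_
      rw [← Finset.mul_sum]
      by_cases h0 : nLaw Q n P xs ys y0 = 0
      · simp [h0]
      congr 1
      rw [hout]
      simp only [hys, hpi]
      have hS : (∑ xs, nLaw Q n P xs ys y0) ≠ 0 := by
        intro hz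
        rw [Finset.sum_eq_zero_iff_of_nonneg (fun xs _ => hW0 xs ys y0)] at hz
        exact h0 (hz xs (Finset.mem_univ _))
      rw [hout] at hS
      have hp := left_ne_zero_of_mul hS
      have hR := right_ne_zero_of_mul hS
      unfold nLaw at h0
      have hPx := left_ne_zero_of_mul h0
      have hq := right_ne_zero_of_mul h0
      have hR' := Finset.prod_ne_zero_iff.1 hR
      have hq' := Finset.prod_ne_zero_iff.1 hq
      unfold infoDens
      rw [← Real.log_prod (fun t ht => div_ne_zero (hq' t ht) (hR' t ht)), Finset.prod_div_distrib]
      congr 1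
      unfold nLaw
      field_simp
    have h2 : condMI (nLaw Q n P) = ∑ t : Fin n, ∑ xs, ∑ ys, ∑ y0, nLaw Q n P xs ys y0 *
        infoDens Q Pstar (xs t) (prevState n y0 ys t) (ys t) := by
      rw [h1]
      exact (sum_rot _).symm
    rw [h2]
    refine Finset.sum_congr rfl fun t _ => ?_
    rw [fbMI_eq Q hQ, ← hmargF t (fun x y' => ∑ y, Q x y' y * infoDens Q Pstar x y' y)]
    refine Finset.sum_congr rfl fun xs _ => ?_
    rw [Finset.sum_comm]
    conv_rhs => rw [Finset.sum_comm]
    refine Finset.sum_congr rfl fun y0 _ => ?_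
    unfold nLaw
    simp only [mul_assoc]
    rw [← Finset.mul_sum, ← Finset.mul_sum]
    congr 1
    exact sum_kernels_fun n (fun t => Q (xs t)) (fun t => hQ.2 (xs t)) y0 t
      (infoDens Q Pstar (xs t))
  rw [hmain, hC]
  have : (n : ℝ) ≠ 0 := by exact_mod_cast hn.ne'
  simp [this]
end
end

section
/- Let W be a memoryless surjective channel with |𝒳| = |𝒴|. There exists δ > 0 such that for every W-centered δ-approximately memoryless POST channel Q, the unique maximizer P* of the optimization problem defining C*_f(Q) has the following simulability property: for every positive integer n and every y_0 ∈ 𝒴, there exists a pmf P_{X^n|Y_0=y_0} on 𝒳^n, with P_{X^n|Y_0=y_0}(x^n) > 0 for all x^n, such that ∑_{x^n ∈ 𝒳^n} P_{X^n|Y_0=y_0}(x^n) ∏_{t=1}^n Q(y_t|x_t, y_{t−1}) = ∏_{t=1}^n P*_{Y|Y′}(y_t|y_{t−1}) for every y^n ∈ 𝒴^n, where P*_{Y|Y′}(y|y′) = ∑_x P*_{X|Y′}(x|y′) Q(y|x,y′). -/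
open scoped BigOperators

noncomputable section

section Helpers

open Real

variable {α : Type*} [Fintype α]

/-- Homogeneous mutual information functional of an unnormalised input. -/
def GG (V : α → α → ℝ) (u : α → ℝ) : ℝ :=
  ∑ y, negMulLog (∑ x, u x * V x y) - negMulLog (∑ x, u x)
    - ∑ x, u x * ∑ y, negMulLog (V x y)

/-- Entropy form of the feedback objective. -/
def FF (Q : α → α → α → ℝ) (P : α → α → ℝ) : ℝ :=
  ∑ y', GG (fun x y => Q x y' y) (fun x => P x y')

lemma sum_out (V : α → α → ℝ) (hV : ∀ x, ∑ y, V x y = 1) (u : α → ℝ) :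
    ∑ y, ∑ x, u x * V x y = ∑ x, u x := by
  rw [Finset.sum_comm]
  simp [← Finset.mul_sum, hV]

lemma fbMI_eq_s12 (Q : α → α → α → ℝ) (hQ : IsPOST Q) (P : α → α → ℝ)
    (hP : ∀ x y, 0 ≤ P x y) : fbMI Q P = FF Q P := by
  obtain ⟨hQ0, hQ1⟩ := hQ
  have h1 : ∀ x c, ∑ b, P x c * Q x c b = P x c := by
    intro x c; rw [← Finset.mul_sum, hQ1, mul_one]
  have key : ∀ x y c, P x c * Q x c y *
      Real.log ((P x c * Q x c y * ∑ a', P a' c) / (P x c * ∑ a', P a' c * Q a' c y))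
      = P x c * Q x c y * log (∑ a', P a' c) - P x c * negMulLog (Q x c y)
        - P x c * Q x c y * log (∑ a', P a' c * Q a' c y) := by
    intro x y c
    by_cases hp : P x c = 0
    · simp [hp]
    by_cases hq : Q x c y = 0
    · simp [hq]
    have hp' : 0 < P x c := lt_of_le_of_ne (hP _ _) (Ne.symm hp)
    have hq' : 0 < Q x c y := lt_of_le_of_ne (hQ0 _ _ _) (Ne.symm hq)
    have hS : 0 < ∑ a', P a' c :=
      lt_of_lt_of_le hp' (Finset.single_le_sum (f := fun a => P a c) (fun i _ => hP i c) (Finset.mem_univ x))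
    have hR : 0 < ∑ a', P a' c * Q a' c y :=
      lt_of_lt_of_le (mul_pos hp' hq') (Finset.single_le_sum (f := fun a => P a c * Q a c y)
        (fun i _ => mul_nonneg (hP i c) (hQ0 _ _ _)) (Finset.mem_univ x))
    rw [log_div (by positivity) (by positivity), log_mul (by positivity) (by positivity),
      log_mul (by positivity) (by positivity), log_mul (by positivity) (by positivity), negMulLog]
    ring
  unfold fbMI condMI FF GG
  simp only [h1, key]
  have e1 : ∀ f : α → α → α → ℝ, ∑ x, ∑ y, ∑ c, f x y c = ∑ c, ∑ x, ∑ y, f x y c := by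
    intro f
    rw [Finset.sum_comm (γ := α) (s := Finset.univ) (t := Finset.univ)
      (f := fun c x => ∑ y, f x y c)]
    exact Finset.sum_congr rfl fun x _ => Finset.sum_comm
  rw [e1]
  refine Finset.sum_congr rfl fun c _ => ?_
  simp only [Finset.sum_sub_distrib]
  have a1 : ∑ x, ∑ y, P x c * Q x c y * log (∑ a', P a' c) = - negMulLog (∑ x, P x c) := by
    simp only [← Finset.sum_mul, h1, negMulLog]; ring
  have a2 : ∑ x, ∑ y, P x c * negMulLog (Q x c y) = ∑ x, P x c * ∑ y, negMulLog (Q x c y) := by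
    simp only [Finset.mul_sum]
  have a3 : ∑ x, ∑ y, P x c * Q x c y * log (∑ a', P a' c * Q a' c y)
      = - ∑ y, negMulLog (∑ x, P x c * Q x c y) := by
    rw [Finset.sum_comm]
    simp only [← Finset.sum_mul, negMulLog, Finset.sum_neg_distrib, neg_mul, neg_neg]
  rw [a1, a2, a3]; ring

lemma mlMI_eq (W : α → α → ℝ) (hW0 : ∀ x y, 0 ≤ W x y) (p : α → ℝ) (hp : IsPmf p) :
    mlMI W p = GG W p := by
  have key : ∀ x y, p x * W x y * Real.log (W x y / ∑ x' , p x' * W x' y)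
      = - (p x * negMulLog (W x y)) - p x * W x y * log (∑ x' , p x' * W x' y) := by
    intro x y
    by_cases h1 : p x = 0
    · simp [h1]
    by_cases hq : W x y = 0
    · simp [hq]
    have hp' : 0 < p x := lt_of_le_of_ne (hp.1 _) (Ne.symm h1)
    have hq' : 0 < W x y := lt_of_le_of_ne (hW0 _ _) (Ne.symm hq)
    have hR : 0 < ∑ a', p a' * W a' y :=
      lt_of_lt_of_le (mul_pos hp' hq') (Finset.single_le_sum (f := fun a => p a * W a y)
        (fun i _ => mul_nonneg (hp.1 i) (hW0 _ _)) (Finset.mem_univ x))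
    rw [log_div (by positivity) (by positivity), negMulLog]
    ring
  unfold mlMI GG
  simp only [key, Finset.sum_sub_distrib, hp.2]
  have a3 : ∑ x, ∑ y, p x * W x y * log (∑ a', p a' * W a' y)
      = - ∑ y, negMulLog (∑ x, p x * W x y) := by
    rw [Finset.sum_comm]
    simp only [← Finset.sum_mul, negMulLog, Finset.sum_neg_distrib, neg_mul, neg_neg]
  rw [a3]
  simp [Finset.mul_sum]
  ring

lemma GG_smul (V : α → α → ℝ) (hV : ∀ x, ∑ y, V x y = 1) (u : α → ℝ) (c : ℝ) :
    GG V (fun x => c * u x) = c * GG V u := by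
  unfold GG
  simp only [mul_assoc, ← Finset.mul_sum, negMulLog_mul, Finset.sum_add_distrib]
  rw [← Finset.sum_mul, sum_out V hV]
  ring

lemma logsum {a b S T : ℝ} (ha : 0 ≤ a) (hb : 0 ≤ b) (hS : 0 < S) (hT : 0 < T) :
    (negMulLog a + a * log S) + (negMulLog b + b * log T)
      ≤ negMulLog (a + b) + (a + b) * log (S + T) ∧
    ((negMulLog a + a * log S) + (negMulLog b + b * log T)
      = negMulLog (a + b) + (a + b) * log (S + T) → a / S = b / T) := by
  have hom : ∀ a S : ℝ, 0 < S → S * negMulLog (a / S) = negMulLog a + a * log S := by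
    intro a S hS
    by_cases h : a = 0
    · simp [h]
    rw [negMulLog, negMulLog, log_div h hS.ne']
    field_simp; ring
  rw [← hom a S hS, ← hom b T hT, ← hom (a+b) (S+T) (by positivity)]
  have hw : S / (S + T) + T / (S + T) = 1 := by field_simp
  have hmid : S / (S + T) * (a / S) + T / (S + T) * (b / T) = (a + b) / (S + T) := by
    field_simp
  constructor
  · have := strictConcaveOn_negMulLog.concaveOn.2
      (show a / S ∈ Set.Ici 0 from Set.mem_Ici.2 (by positivity)) (show b / T ∈ Set.Ici 0 from Set.mem_Ici.2 (by positivity))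
      (show 0 ≤ S / (S + T) by positivity) (show 0 ≤ T / (S + T) by positivity) hw
    simp only [smul_eq_mul] at this
    rw [hmid] at this
    have h2 := mul_le_mul_of_nonneg_left this (show 0 ≤ S + T by positivity)
    calc _ = (S + T) * (S / (S + T) * negMulLog (a / S) + T / (S + T) * negMulLog (b / T)) := by
          field_simp
      _ ≤ _ := h2
  · intro heq
    by_contra hne
    have := strictConcaveOn_negMulLog.2
      (show a / S ∈ Set.Ici 0 from Set.mem_Ici.2 (by positivity)) (show b / T ∈ Set.Ici 0 from Set.mem_Ici.2 (by positivity)) hne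
      (show 0 < S / (S + T) by positivity) (show 0 < T / (S + T) by positivity) hw
    simp only [smul_eq_mul] at this
    rw [hmid] at this
    have h2 := mul_lt_mul_of_pos_left this (show 0 < S + T by positivity)
    have h3 : S * negMulLog (a / S) + T * negMulLog (b / T) = (S + T) * (S / (S + T) * negMulLog (a / S) + T / (S + T) * negMulLog (b / T)) := by
          field_simp
    rw [← h3, heq] at h2
    exact lt_irrefl _ h2

lemma GG_add [DecidableEq α] (V : α → α → ℝ) (hV0 : ∀ x y, 0 ≤ V x y) (hV : ∀ x, ∑ y, V x y = 1)
    (hinv : IsUnit ((Matrix.of fun y x => V x y) : Matrix α α ℝ))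
    (u v : α → ℝ) (hu : ∀ x, 0 ≤ u x) (hv : ∀ x, 0 ≤ v x)
    (hS : 0 < ∑ x, u x) (hT : 0 < ∑ x, v x) :
    GG V u + GG V v ≤ GG V (fun x => u x + v x) ∧
    (GG V u + GG V v = GG V (fun x => u x + v x) →
      ∀ x, u x / (∑ x, u x) = v x / (∑ x, v x)) := by
  set S := ∑ x, u x with hSd
  set T := ∑ x, v x with hTd
  have rep : ∀ w : α → ℝ, GG V w = ∑ y, (negMulLog (∑ x, w x * V x y)
      + (∑ x, w x * V x y) * log (∑ x, w x)) - ∑ x, w x * ∑ y, negMulLog (V x y) := by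
    intro w
    rw [Finset.sum_add_distrib, ← Finset.sum_mul, sum_out V hV, GG, negMulLog]
    simp only [negMulLog]
    ring
  have hls : ∀ y, _ := fun y => logsum (a := ∑ x, u x * V x y) (b := ∑ x, v x * V x y)
    (Finset.sum_nonneg fun x _ => mul_nonneg (hu x) (hV0 x y))
    (Finset.sum_nonneg fun x _ => mul_nonneg (hv x) (hV0 x y)) hS hT
  have hr : GG V (fun x => u x + v x) = ∑ y, (negMulLog (∑ x, u x * V x y + ∑ x, v x * V x y)
      + (∑ x, u x * V x y + ∑ x, v x * V x y) * log (S + T))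
      - (∑ x, u x * ∑ y, negMulLog (V x y) + ∑ x, v x * ∑ y, negMulLog (V x y)) := by
    rw [rep]
    simp only [add_mul, Finset.sum_add_distrib]
    rfl
  rw [hr, rep u, rep v]
  constructor
  · have := Finset.sum_le_sum (fun y (_ : y ∈ Finset.univ) => (hls y).1)
    rw [Finset.sum_add_distrib] at this
    linarith
  · intro heq
    have h1 : ∑ y, ((negMulLog (∑ x, u x * V x y) + (∑ x, u x * V x y) * log S)
        + (negMulLog (∑ x, v x * V x y) + (∑ x, v x * V x y) * log T))
      = ∑ y, (negMulLog (∑ x, u x * V x y + ∑ x, v x * V x y)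
        + (∑ x, u x * V x y + ∑ x, v x * V x y) * log (S + T)) := by
      rw [Finset.sum_add_distrib]
      linarith
    have h2 := (Finset.sum_eq_sum_iff_of_le (fun y _ => (hls y).1)).1 h1
    have h3 : ∀ y, (∑ x, u x * V x y) / S = (∑ x, v x * V x y) / T :=
      fun y => (hls y).2 (h2 y (Finset.mem_univ y))
    have hinj := Matrix.mulVec_injective_of_isUnit hinv
    have h4 : (fun x => u x / S) = (fun x => v x / T) := by
      apply hinj
      ext y
      simp only [Matrix.mulVec, dotProduct, Matrix.of_apply]
      have := h3 y
      rw [Finset.sum_div, Finset.sum_div] at this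
      convert this using 2 <;> ring
    exact fun x => congrFun h4 x

/-- Existence of a stationary distribution. -/
lemma exists_stat [Nonempty α] [DecidableEq α] (K : α → α → ℝ) (hK0 : ∀ a b, 0 ≤ K a b)
    (hK1 : ∀ a, ∑ b, K a b = 1) :
    ∃ q : α → ℝ, IsPmf q ∧ ∀ b, ∑ a, q a * K a b = q b := by
  let M : Matrix α α ℝ := Matrix.of K - 1
  have hM : M.mulVec (fun _ => 1) = 0 := by
    ext a
    simp [M, Matrix.mulVec, dotProduct, hK1, Matrix.one_apply]
  have hdet : M.det = 0 := by
    apply Matrix.exists_mulVec_eq_zero_iff.1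
    refine ⟨fun _ => 1, ?_, hM⟩
    intro h
    have := congrFun h (Classical.arbitrary α)
    simp at this
  obtain ⟨v, hv0, hv⟩ := Matrix.exists_vecMul_eq_zero_iff.2 hdet
  have hv' : ∀ b, ∑ a, v a * K a b = v b := by
    intro b
    have := congrFun hv b
    simp [M, Matrix.vecMul, dotProduct, Matrix.one_apply, mul_sub] at this
    linarith
  have hle : ∀ b ∈ Finset.univ, |v b| ≤ ∑ a, |v a| * K a b := by
    intro b _
    conv_lhs => rw [← hv' b]
    refine (Finset.abs_sum_le_sum_abs _ _).trans (le_of_eq ?_)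
    refine Finset.sum_congr rfl fun a _ => ?_
    rw [abs_mul, abs_of_nonneg (hK0 a b)]
  have hs : ∑ b, |v b| = ∑ b, ∑ a, |v a| * K a b := by
    rw [sum_out K hK1]
  have heq := (Finset.sum_eq_sum_iff_of_le hle).1 hs
  have hpos : 0 < ∑ b, |v b| := by
    obtain ⟨b, hb⟩ := Function.ne_iff.1 hv0
    exact lt_of_lt_of_le (abs_pos.2 hb)
      (Finset.single_le_sum (f := fun b => |v b|) (fun i _ => abs_nonneg _) (Finset.mem_univ b))
  refine ⟨fun a => |v a| / ∑ b, |v b|, ⟨fun x => by positivity, ?_⟩, fun b => ?_⟩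
  · rw [← Finset.sum_div, div_self hpos.ne']
  · show ∑ a, |v a| / (∑ b, |v b|) * K a b = |v b| / ∑ b, |v b|
    have h := heq b (Finset.mem_univ b)
    calc _ = (∑ a, |v a| * K a b) / ∑ b, |v b| := by
          rw [Finset.sum_div]
          exact Finset.sum_congr rfl fun a _ => by ring
      _ = _ := by rw [← h]

lemma W_unique [DecidableEq α]
    (W : α → α → ℝ) (hW0 : ∀ x y, 0 ≤ W x y) (hW1 : ∀ x, ∑ y : α, W x y = 1)
    (pX : α → ℝ) (hpX : IsPmf pX)
    (hpXopt : ∀ p : α → ℝ, IsPmf p → mlMI W p ≤ mlMI W pX)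
    (hinv : IsUnit ((Matrix.of fun y x => W x y) : Matrix α α ℝ))
    (P : α → α → ℝ) (hP : IsJointPmf P) (hst : StationaryFor (fun x _ y => W x y) P)
    (hge : GG W pX ≤ FF (fun x _ y => W x y) P) :
    P = fun x y => pX x * ∑ x', pX x' * W x' y := by
  have hopt : ∀ p, IsPmf p → GG W p ≤ GG W pX := by
    intro p hp
    rw [← mlMI_eq W hW0 p hp, ← mlMI_eq W hW0 pX hpX]
    exact hpXopt p hp
  have huniq : ∀ p, IsPmf p → GG W p = GG W pX → p = pX := by
    intro p hp he
    have h := GG_add W hW0 hW1 hinv p pX hp.1 hpX.1 (by rw [hp.2]; norm_num) (by rw [hpX.2]; norm_num)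
    have hmid : GG W (fun x => p x + pX x) ≤ 2 * GG W pX := by
      have e : (fun x => p x + pX x) = fun x => 2 * ((p x + pX x) / 2) := by ext x; ring
      rw [e, GG_smul W hW1 (fun x => (p x + pX x) / 2) 2]
      have := hopt (fun x => (p x + pX x) / 2) ⟨fun x => by
        have := hp.1 x; have := hpX.1 x; positivity, by
        rw [← Finset.sum_div, Finset.sum_add_distrib, hp.2, hpX.2]; norm_num⟩
      linarith
    have h2 := h.2 (le_antisymm h.1 (by rw [he]; linarith))
    ext x
    have := h2 x
    rw [hp.2, hpX.2] at this
    simpa using this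
  set S : α → ℝ := fun y => ∑ x, P x y with hS
  have hS0 : ∀ y, 0 ≤ S y := fun y => Finset.sum_nonneg fun x _ => hP.1 x y
  have hS1 : ∑ y, S y = 1 := by
    rw [← hP.2, Finset.sum_comm]
  have hzero : ∀ y, S y = 0 → ∀ x, P x y = 0 := by
    intro y hy x
    exact (Finset.sum_eq_zero_iff_of_nonneg (fun x _ => hP.1 x y)).1 hy x (Finset.mem_univ x)
  have hpm : ∀ y, S y ≠ 0 → IsPmf (fun x => P x y / S y) := by
    intro y hy
    refine ⟨fun x => div_nonneg (hP.1 x y) (hS0 y), ?_⟩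
    rw [← Finset.sum_div]
    exact div_self hy
  have hG : ∀ y, S y ≠ 0 → GG W (fun x => P x y) = S y * GG W (fun x => P x y / S y) := by
    intro y hy
    rw [← GG_smul W hW1]
    congr 1
    ext x
    field_simp
  have hle : ∀ y ∈ Finset.univ, GG W (fun x => P x y) ≤ S y * GG W pX := by
    intro y _
    by_cases hy : S y = 0
    · have e : (fun x => P x y) = fun x => 0 * (0 : ℝ) := by
        ext x; simp [hzero y hy x]
      rw [e, hy, GG_smul W hW1 (fun _ => 0) 0]; simp
    · rw [hG y hy]
      exact mul_le_mul_of_nonneg_left (hopt _ (hpm y hy)) (hS0 y)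
  have hsum : ∑ y, GG W (fun x => P x y) = ∑ y, S y * GG W pX := by
    apply le_antisymm (Finset.sum_le_sum hle)
    rw [← Finset.sum_mul, hS1, one_mul]
    exact hge
  have heq := (Finset.sum_eq_sum_iff_of_le hle).1 hsum
  have hPS : ∀ x y, P x y = pX x * S y := by
    intro x y
    by_cases hy : S y = 0
    · rw [hy, hzero y hy, mul_zero]
    · have h1 := heq y (Finset.mem_univ y)
      rw [hG y hy] at h1
      have h2 := huniq _ (hpm y hy) (mul_left_cancel₀ hy h1)
      rw [← h2]
      field_simp
  have hSr : ∀ y, S y = ∑ x', pX x' * W x' y := by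
    intro y
    have h := hst y
    change _ = S y at h
    rw [← h]
    refine Finset.sum_congr rfl fun x _ => ?_
    simp only [hPS]
    rw [← Finset.sum_mul, ← Finset.mul_sum, hS1, mul_one]
  ext x y
  rw [hPS, hSr]

lemma FF_continuous : Continuous (fun z : (α → α → α → ℝ) × (α → α → ℝ) => FF z.1 z.2) := by
  unfold FF GG
  have := Real.continuous_negMulLog
  fun_prop

/-- Feasible product input. -/
lemma exists_feasible [Nonempty α] [DecidableEq α] (pX : α → ℝ) (hpX : IsPmf pX)
    (Q : α → α → α → ℝ) (hQ : IsPOST Q) :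
    ∃ q : α → ℝ, IsPmf q ∧ IsJointPmf (fun x y => pX x * q y) ∧
      StationaryFor Q (fun x y => pX x * q y) := by
  obtain ⟨q, hq, hs⟩ := exists_stat (fun y' y => ∑ x, pX x * Q x y' y)
    (fun a b => Finset.sum_nonneg fun x _ => mul_nonneg (hpX.1 x) (hQ.1 _ _ _))
    (fun a => by rw [sum_out (fun x y => Q x a y) (fun x => hQ.2 x a)]; exact hpX.2)
  refine ⟨q, hq, ⟨fun x y => mul_nonneg (hpX.1 x) (hq.1 y), ?_⟩, fun y => ?_⟩
  · simp [← Finset.mul_sum, hq.2, hpX.2]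
  · rw [← Finset.sum_mul, hpX.2, one_mul, ← hs y, Finset.sum_comm]
    refine Finset.sum_congr rfl fun a _ => ?_
    rw [Finset.mul_sum]
    exact Finset.sum_congr rfl fun x _ => by ring

lemma jointPmf_le_one (P : α → α → ℝ) (hP : IsJointPmf P) (x y : α) : P x y ≤ 1 := by
  rw [← hP.2]
  calc P x y ≤ ∑ y, P x y :=
        Finset.single_le_sum (f := fun y => P x y) (fun i _ => hP.1 x i) (Finset.mem_univ y)
    _ ≤ _ := Finset.single_le_sum (f := fun x => ∑ y, P x y)
        (fun i _ => Finset.sum_nonneg fun y _ => hP.1 i y) (Finset.mem_univ x)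

lemma isClosed_jointPmf : IsClosed {P : α → α → ℝ | IsJointPmf P} := by
  unfold IsJointPmf
  simp only [Set.ofPred_and, Set.ofPred_forall]
  refine IsClosed.inter (isClosed_iInter fun x => isClosed_iInter fun y =>
    isClosed_le (by fun_prop) (by fun_prop)) (isClosed_eq (by fun_prop) (by fun_prop))

lemma isClosed_stat : IsClosed {z : (α → α → α → ℝ) × (α → α → ℝ) | StationaryFor z.1 z.2} := by
  unfold StationaryFor
  simp only [Set.ofPred_forall]
  exact isClosed_iInter fun y => isClosed_eq (by fun_prop) (by fun_prop)

lemma isClosed_post : IsClosed {Q : α → α → α → ℝ | IsPOST Q} := by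
  unfold IsPOST
  simp only [Set.ofPred_and, Set.ofPred_forall]
  exact IsClosed.inter (isClosed_iInter fun x => isClosed_iInter fun y => isClosed_iInter fun z =>
    isClosed_le (by fun_prop) (by fun_prop)) (isClosed_iInter fun x => isClosed_iInter fun y =>
    isClosed_eq (by fun_prop) (by fun_prop))

lemma isClosed_pmf : IsClosed {p : α → ℝ | IsPmf p} := by
  unfold IsPmf
  simp only [Set.ofPred_and, Set.ofPred_forall]
  exact IsClosed.inter (isClosed_iInter fun x =>
    isClosed_le (by fun_prop) (by fun_prop)) (isClosed_eq (by fun_prop) (by fun_prop))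

lemma exists_max [Nonempty α] [DecidableEq α] (pX : α → ℝ) (hpX : IsPmf pX)
    (Q : α → α → α → ℝ) (hQ : IsPOST Q) : ∃ P, IsFbMaximizer Q P := by
  obtain ⟨q, -, h1, h2⟩ := exists_feasible pX hpX Q hQ
  have hcl : IsClosed {P : α → α → ℝ | IsJointPmf P ∧ StationaryFor Q P} :=
    isClosed_jointPmf.inter (isClosed_stat.preimage (f := fun P => (Q, P)) (by fun_prop))
  have hc : IsCompact {P : α → α → ℝ | IsJointPmf P ∧ StationaryFor Q P} := by
    refine IsCompact.of_isClosed_subset (isCompact_Icc (a := (0 : α → α → ℝ)) (b := 1)) hcl ?_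
    intro P hP
    exact ⟨fun x y => hP.1.1 x y, fun x y => jointPmf_le_one P hP.1 x y⟩
  obtain ⟨P, hP, hmax⟩ := hc.exists_isMaxOn ⟨_, h1, h2⟩
    (f := fun P => FF Q P) ((FF_continuous.comp (by fun_prop : Continuous fun P => (Q, P))).continuousOn)
  refine ⟨P, hP.1, hP.2, fun P' hP' hs' => ?_⟩
  rw [fbMI_eq_s12 Q hQ P hP.1.1, fbMI_eq_s12 Q hQ P' hP'.1]
  exact hmax ⟨hP', hs'⟩

lemma max_close [Nonempty α] [DecidableEq α]
    (W : α → α → ℝ) (hW0 : ∀ x y, 0 ≤ W x y) (hW1 : ∀ x, ∑ y : α, W x y = 1)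
    (pX : α → ℝ) (hpX : IsPmf pX)
    (hpXopt : ∀ p : α → ℝ, IsPmf p → mlMI W p ≤ mlMI W pX)
    (hinv : IsUnit ((Matrix.of fun y x => W x y) : Matrix α α ℝ))
    (U : Set ((α → α → α → ℝ) × (α → α → ℝ)))
    (hU : U ∈ nhds ((fun x _ y => W x y, fun x y => pX x * ∑ x', pX x' * W x' y) :
      (α → α → α → ℝ) × (α → α → ℝ))) :
    ∃ δ > (0 : ℝ), ∀ Q : α → α → α → ℝ, IsPOST Q →
      (∀ x y' y, |Q x y' y - W x y| ≤ δ) → ∀ P, IsFbMaximizer Q P → (Q, P) ∈ U := by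
  let T : Set ((α → α → α → ℝ) × (α → α → ℝ) × (α → ℝ)) :=
    {z | IsPOST z.1} ∩ {z | IsJointPmf z.2.1} ∩ {z | StationaryFor z.1 z.2.1} ∩
    {z | IsPmf z.2.2} ∩ {z | FF z.1 (fun x y => pX x * z.2.2 y) ≤ FF z.1 z.2.1} ∩
    {z | (z.1, z.2.1) ∈ (interior U)ᶜ}
  have hTcl : IsClosed T := by
    refine ((((IsClosed.inter ?_ ?_).inter ?_).inter ?_).inter ?_).inter ?_
    · exact isClosed_post.preimage continuous_fst
    · exact isClosed_jointPmf.preimage (f := fun z : (α → α → α → ℝ) × (α → α → ℝ) × (α → ℝ) => z.2.1) (by fun_prop)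
    · exact isClosed_stat.preimage (f := fun z : (α → α → α → ℝ) × (α → α → ℝ) × (α → ℝ) => (z.1, z.2.1)) (by fun_prop)
    · exact isClosed_pmf.preimage (f := fun z : (α → α → α → ℝ) × (α → α → ℝ) × (α → ℝ) => z.2.2) (by fun_prop)
    · refine isClosed_le ?_ ?_
      · exact FF_continuous.comp (f := fun z : (α → α → α → ℝ) × (α → α → ℝ) × (α → ℝ) => (z.1, fun x y => pX x * z.2.2 y)) (by fun_prop)
      · exact FF_continuous.comp (f := fun z : (α → α → α → ℝ) × (α → α → ℝ) × (α → ℝ) => (z.1, z.2.1)) (by fun_prop)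
    · exact isOpen_interior.isClosed_compl.preimage (f := fun z : (α → α → α → ℝ) × (α → α → ℝ) × (α → ℝ) => (z.1, z.2.1)) (by fun_prop)
  have hTc : IsCompact T := by
    refine IsCompact.of_isClosed_subset (isCompact_Icc
      (a := (0 : (α → α → α → ℝ) × (α → α → ℝ) × (α → ℝ))) (b := 1)) hTcl ?_
    rintro ⟨Q, P, q⟩ ⟨⟨⟨⟨⟨h1, h2⟩, h3⟩, h4⟩, h5⟩, h6⟩
    simp only [Set.mem_ofPred_eq] at h1 h2 h4
    refine ⟨⟨fun x y z => h1.1 x y z, fun x y => h2.1 x y, fun x => h4.1 x⟩,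
      ⟨fun x y z => ?_, fun x y => jointPmf_le_one P h2 x y, fun x => ?_⟩⟩
    · show Q x y z ≤ 1
      rw [← h1.2 x y]
      exact Finset.single_le_sum (f := fun z => Q x y z) (fun i _ => h1.1 x y i) (Finset.mem_univ z)
    · show q x ≤ 1
      rw [← h4.2]
      exact Finset.single_le_sum (f := fun z => q z) (fun i _ => h4.1 i) (Finset.mem_univ x)
  have hmem : ∀ Q, IsPOST Q → ∀ P, IsFbMaximizer Q P → (Q, P) ∉ U → ∃ q, (Q, P, q) ∈ T := by
    intro Q hQ P hP hn
    obtain ⟨q, hq, h1, h2⟩ := exists_feasible pX hpX Q hQ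
    refine ⟨q, ⟨⟨⟨⟨hQ, hP.1⟩, hP.2.1⟩, hq⟩, ?_⟩, fun h => hn (interior_subset h)⟩
    have := hP.2.2 _ h1 h2
    rw [fbMI_eq_s12 Q hQ P hP.1.1, fbMI_eq_s12 Q hQ _ h1.1] at this
    exact this
  rcases T.eq_empty_or_nonempty with hE | hne
  · refine ⟨1, one_pos, fun Q hQ _ P hP => ?_⟩
    by_contra hn
    obtain ⟨q, hq⟩ := hmem Q hQ P hP hn
    rw [hE] at hq
    exact hq
  · obtain ⟨z, hz, hmin⟩ := hTc.exists_isMinOn hne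
      (f := fun z => dist z.1 (fun x _ y => W x y)) (by fun_prop)
    have hpos : 0 < dist z.1 (fun x _ y => W x y) := by
      refine lt_of_le_of_ne dist_nonneg (fun h0 => ?_)
      have hzW : z.1 = fun x _ y => W x y := dist_eq_zero.1 h0.symm
      obtain ⟨Q, P, q⟩ := z
      simp only at hzW
      subst hzW
      obtain ⟨⟨⟨⟨⟨h1, h2⟩, h3⟩, h4⟩, h5⟩, h6⟩ := hz
      simp only [Set.mem_ofPred_eq] at h1 h2 h3 h4 h5 h6
      have hFF : FF (fun x _ y => W x y) (fun x y => pX x * q y) = GG W pX := by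
        unfold FF
        have : ∀ y, GG W (fun x => pX x * q y) = q y * GG W pX := by
          intro y
          rw [← GG_smul W hW1]
          congr 1; ext x; ring
        simp only [this]
        rw [← Finset.sum_mul, h4.2, one_mul]
      rw [hFF] at h5
      have := W_unique W hW0 hW1 pX hpX hpXopt hinv P h2 h3 h5
      rw [this] at h6
      exact h6 (mem_interior_iff_mem_nhds.2 hU)
    refine ⟨_, half_pos hpos, fun Q hQ hd P hP => ?_⟩
    by_contra hn
    obtain ⟨q, hq⟩ := hmem Q hQ P hP hn
    have h1 := hmin hq
    simp only [Set.mem_ofPred_eq] at h1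
    have h2 : dist Q (fun x _ y => W x y) ≤ dist z.1 (fun x _ y => W x y) / 2 := by
      refine (dist_pi_le_iff (by positivity)).2 fun x => (dist_pi_le_iff (by positivity)).2
        fun y => (dist_pi_le_iff (by positivity)).2 fun w => ?_
      rw [Real.dist_eq]
      exact hd x y w
    linarith

/-- Recursive simulating input law. -/
def vv (A : α → α → α → ℝ) : (n : ℕ) → α → (Fin n → α) → ℝ
  | 0, _, _ => 1
  | n + 1, y0, xs => ∑ y1, A y0 (xs 0) y1 * vv A n y1 (fun i => xs i.succ)

lemma vv_cons (A : α → α → α → ℝ) (n : ℕ) (y0 x : α) (xs : Fin n → α) :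
    vv A (n + 1) y0 (Fin.cons x xs) = ∑ y1, A y0 x y1 * vv A n y1 xs := by
  simp [vv]

lemma sum_cons (n : ℕ) (f : (Fin (n + 1) → α) → ℝ) :
    ∑ xs, f xs = ∑ x, ∑ xs : Fin n → α, f (Fin.cons x xs) := by
  rw [← (Fin.consEquiv (fun _ : Fin (n + 1) => α)).sum_comp, Fintype.sum_prod_type]
  rfl

lemma vv_bounds [Nonempty α] (A : α → α → α → ℝ) (m C ε η : ℝ) (hm : 0 < m) (hε : 0 < ε)
    (hc : ∀ y0 x, 2 * m ≤ ∑ y1, A y0 x y1) (hC : ∀ y0 x y1, |A y0 x y1| ≤ C)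
    (hη : ∀ y0 y0' x y1, |A y0 x y1 - A y0' x y1| ≤ η)
    (h1 : Fintype.card α * (C * ε) ≤ m) (h2 : Fintype.card α * (η * (1 + ε)) ≤ ε * m) (n : ℕ) :
    ∀ xs : Fin n → α, (∀ y, 0 < vv A n y xs) ∧
      ∀ y y', |vv A n y xs - vv A n y' xs| ≤ ε * vv A n y' xs := by
  induction n with
  | zero => intro xs; simp [vv, hε.le]
  | succ n ih =>
    intro xs
    obtain ⟨x, xs, rfl⟩ : ∃ x xs', xs = Fin.cons x xs' := ⟨xs 0, Fin.tail xs, (Fin.cons_self_tail xs).symm⟩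
    obtain ⟨ihp, ihd⟩ := ih xs
    simp only [vv_cons]
    let ys := Classical.arbitrary α
    set b := vv A n ys xs with hb
    have hbp : 0 < b := ihp ys
    have hC0 : 0 ≤ C := (abs_nonneg _).trans (hC ys ys ys)
    have hη0 : 0 ≤ η := (abs_nonneg _).trans (hη ys ys ys ys)
    have low : ∀ y0, m * b ≤ ∑ y1, A y0 x y1 * vv A n y1 xs := by
      intro y0
      have e : ∑ y1, A y0 x y1 * vv A n y1 xs
          = (∑ y1, A y0 x y1) * b + ∑ y1, A y0 x y1 * (vv A n y1 xs - b) := by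
        rw [Finset.sum_mul, ← Finset.sum_add_distrib]
        exact Finset.sum_congr rfl fun _ _ => by ring
      have e2 : |∑ y1, A y0 x y1 * (vv A n y1 xs - b)| ≤ Fintype.card α * (C * ε) * b := by
        calc _ ≤ ∑ y1, |A y0 x y1 * (vv A n y1 xs - b)| := Finset.abs_sum_le_sum_abs _ _
          _ ≤ ∑ _y1 : α, C * (ε * b) := by
            refine Finset.sum_le_sum fun y1 _ => ?_
            rw [abs_mul]
            exact mul_le_mul (hC _ _ _) (ihd y1 ys) (abs_nonneg _) hC0
          _ = _ := by simp; ring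
      have e3 := (abs_le.1 e2).1
      have e4 := mul_le_mul_of_nonneg_right h1 hbp.le
      have e5 := mul_le_mul_of_nonneg_right (hc y0 x) hbp.le
      rw [e]
      linarith
    refine ⟨fun y => lt_of_lt_of_le (by positivity) (low y), fun y y' => ?_⟩
    have e2 : |∑ y1, A y x y1 * vv A n y1 xs - ∑ y1, A y' x y1 * vv A n y1 xs|
        ≤ Fintype.card α * (η * (1 + ε)) * b := by
      rw [← Finset.sum_sub_distrib]
      calc _ ≤ ∑ y1, |A y x y1 * vv A n y1 xs - A y' x y1 * vv A n y1 xs| :=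
            Finset.abs_sum_le_sum_abs _ _
        _ ≤ ∑ _y1 : α, η * ((1 + ε) * b) := by
          refine Finset.sum_le_sum fun y1 _ => ?_
          rw [← sub_mul, abs_mul, abs_of_pos (ihp y1)]
          have := (abs_le.1 (ihd y1 ys)).2
          exact mul_le_mul (hη _ _ _ _) (by linarith) (ihp y1).le hη0
        _ = _ := by simp; ring
    have e4 := mul_le_mul_of_nonneg_right h2 hbp.le
    have e5 := mul_le_mul_of_nonneg_left (low y') hε.le
    linarith

lemma prevState_zero (n : ℕ) (y0 : α) (ys : Fin (n + 1) → α) :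
    prevState (n + 1) y0 ys 0 = y0 := by simp [prevState]

lemma prevState_succ (n : ℕ) (y0 y1 : α) (ys : Fin n → α) (t : Fin n) :
    prevState (n + 1) y0 (Fin.cons y1 ys : Fin (n + 1) → α) t.succ = prevState n y1 ys t := by
  unfold prevState
  simp only [Fin.val_succ, Nat.succ_ne_zero, if_false, Nat.add_sub_cancel]
  by_cases h : (t : ℕ) = 0
  · have : (⟨(t : ℕ), by omega⟩ : Fin (n + 1)) = 0 := Fin.ext h
    simp only [h, if_true]
    rfl
  · have : (⟨(t : ℕ), by omega⟩ : Fin (n + 1)) = Fin.succ ⟨(t : ℕ) - 1, by omega⟩ :=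
      Fin.ext (by simp; omega)
    rw [if_neg h, this, Fin.cons_succ]

lemma vv_sum (A : α → α → α → ℝ) (K : α → α → ℝ) (hK : ∀ y, ∑ y1, K y y1 = 1)
    (hA : ∀ y0 y1, ∑ x, A y0 x y1 = K y0 y1) (n : ℕ) :
    ∀ y0, ∑ xs, vv A n y0 xs = 1 := by
  induction n with
  | zero => intro y0; simp [vv]
  | succ n ih =>
    intro y0
    rw [sum_cons]
    simp only [vv_cons]
    calc ∑ x, ∑ xs : Fin n → α, ∑ y1, A y0 x y1 * vv A n y1 xs
        = ∑ x, ∑ y1, A y0 x y1 := by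
          refine Finset.sum_congr rfl fun x _ => ?_
          rw [Finset.sum_comm]
          refine Finset.sum_congr rfl fun y1 _ => ?_
          rw [← Finset.mul_sum, ih, mul_one]
      _ = 1 := by
          rw [Finset.sum_comm]
          simp only [hA, hK]

lemma vv_out [DecidableEq α] (Q A : α → α → α → ℝ) (K : α → α → ℝ)
    (hA : ∀ y0 y y1, ∑ x, Q x y0 y * A y0 x y1 = if y = y1 then K y0 y else 0) (n : ℕ) :
    ∀ (y0 : α) (ys : Fin n → α),
      ∑ xs, vv A n y0 xs * ∏ t : Fin n, Q (xs t) (prevState n y0 ys t) (ys t)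
        = ∏ t : Fin n, K (prevState n y0 ys t) (ys t) := by
  induction n with
  | zero => intro y0 ys; simp [vv]
  | succ n ih =>
    intro y0 ys
    obtain ⟨y, ys, rfl⟩ : ∃ x xs', ys = Fin.cons x xs' := ⟨ys 0, Fin.tail ys, (Fin.cons_self_tail ys).symm⟩
    rw [sum_cons]
    simp only [vv_cons, Fin.prod_univ_succ, prevState_zero, prevState_succ, Fin.cons_zero,
      Fin.cons_succ]
    calc ∑ x, ∑ xs : Fin n → α, (∑ y1, A y0 x y1 * vv A n y1 xs) *
            (Q x y0 y * ∏ t, Q (xs t) (prevState n y ys t) (ys t))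
        = ∑ y1, (∑ x, Q x y0 y * A y0 x y1) *
            ∑ xs : Fin n → α, vv A n y1 xs * ∏ t, Q (xs t) (prevState n y ys t) (ys t) := by
          simp only [Finset.sum_mul_sum]
          conv_rhs => rw [Finset.sum_comm]
          simp only [Finset.sum_mul]
          refine Finset.sum_congr rfl fun x _ => ?_
          rw [Finset.sum_comm]
          refine Finset.sum_congr rfl fun y1 _ => ?_
          refine Finset.sum_congr rfl fun xs _ => ?_
          ring
      _ = _ := by
          simp only [hA, ite_mul, zero_mul, Finset.sum_ite_eq, Finset.mem_univ, if_true, ih]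

/-- Transition matrix for a fixed state. -/
def Mat (Q : α → α → α → ℝ) (y0 : α) : Matrix α α ℝ := Matrix.of fun y x => Q x y0 y

/-- Coefficients of the recursion. -/
def AA [DecidableEq α] (Q : α → α → α → ℝ) (P : α → α → ℝ) (y0 x y1 : α) : ℝ :=
  (Mat Q y0)⁻¹ x y1 * condOut Q P y0 y1

lemma AA_out [DecidableEq α] (Q : α → α → α → ℝ) (P : α → α → ℝ)
    (hM : ∀ y0, IsUnit (Mat Q y0)) (y0 y y1 : α) :
    ∑ x, Q x y0 y * AA Q P y0 x y1 = if y = y1 then condOut Q P y0 y else 0 := by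
  have h : Mat Q y0 * (Mat Q y0)⁻¹ = 1 :=
    Matrix.mul_nonsing_inv _ ((Matrix.isUnit_iff_isUnit_det _).1 (hM y0))
  have h1 := congrFun (congrFun h y) y1
  rw [Matrix.mul_apply, Matrix.one_apply] at h1
  simp only [AA, ← mul_assoc]
  rw [← Finset.sum_mul]
  have h2 : ∑ x, Q x y0 y * (Mat Q y0)⁻¹ x y1 = if y = y1 then 1 else 0 := h1
  rw [h2]
  split_ifs with h
  · rw [h, one_mul]
  · simp

lemma AA_sum [DecidableEq α] (Q : α → α → α → ℝ) (hQ : IsPOST Q) (P : α → α → ℝ)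
    (hM : ∀ y0, IsUnit (Mat Q y0)) (y0 y1 : α) :
    ∑ x, AA Q P y0 x y1 = condOut Q P y0 y1 := by
  calc _ = ∑ y, ∑ x, AA Q P y0 x y1 * Q x y0 y :=
        (sum_out (fun x y => Q x y0 y) (fun x => hQ.2 x y0) _).symm
    _ = ∑ y, if y = y1 then condOut Q P y0 y else 0 := by
        refine Finset.sum_congr rfl fun y _ => ?_
        rw [← AA_out Q P hM]
        exact Finset.sum_congr rfl fun x _ => mul_comm _ _
    _ = _ := by simp

lemma condOut_sum (Q : α → α → α → ℝ) (hQ : IsPOST Q) (P : α → α → ℝ) (y' : α)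
    (hP : 0 < ∑ x, P x y') : ∑ y, condOut Q P y' y = 1 := by
  unfold condOut
  rw [← Finset.sum_div, sum_out (fun x y => Q x y' y) (fun x => hQ.2 x y')]
  exact div_self hP.ne'

lemma unique_max [Nonempty α] [DecidableEq α] (Q : α → α → α → ℝ) (hQ : IsPOST Q)
    (hM : ∀ y0, IsUnit (Mat Q y0)) (r : α → ℝ) (P1 P2 : α → α → ℝ)
    (h1 : IsFbMaximizer Q P1) (h2 : IsFbMaximizer Q P2)
    (hS1 : ∀ y, 0 < ∑ x, P1 x y) (hS2 : ∀ y, 0 < ∑ x, P2 x y)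
    (hr : ∀ y' y, |condOut Q P1 y' y - r y| ≤ 1 / (2 * Fintype.card α)) : P1 = P2 := by
  have hadd : ∀ y' ∈ Finset.univ, _ := fun y' (_ : y' ∈ (Finset.univ : Finset α)) =>
    (GG_add (fun x y => Q x y' y) (fun x y => hQ.1 x y' y)
    (fun x => hQ.2 x y') (hM y') (fun x => P1 x y') (fun x => P2 x y')
    (fun x => h1.1.1 x y') (fun x => h2.1.1 x y') (hS1 y') (hS2 y')).1
  have e12 : FF Q P1 = FF Q P2 := by
    have a := h1.2.2 P2 h2.1 h2.2.1
    have b := h2.2.2 P1 h1.1 h1.2.1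
    rw [fbMI_eq_s12 Q hQ P1 h1.1.1, fbMI_eq_s12 Q hQ P2 h2.1.1] at a b
    exact le_antisymm b a
  let Pm : α → α → ℝ := fun x y => (P1 x y + P2 x y) / 2
  have hPm : IsJointPmf Pm := by
    refine ⟨fun x y => ?_, ?_⟩
    · have := h1.1.1 x y; have := h2.1.1 x y; simp only [Pm]; positivity
    · simp only [Pm, ← Finset.sum_div, Finset.sum_add_distrib, h1.1.2, h2.1.2]; norm_num
  have hsm : StationaryFor Q Pm := by
    intro y
    have a := h1.2.1 y
    have b := h2.2.1 y
    have e : ∀ x y', Pm x y' * Q x y' y = (P1 x y' * Q x y' y + P2 x y' * Q x y' y) / 2 := by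
      intro x y'; simp only [Pm]; ring
    simp only [e]
    simp only [Pm, ← Finset.sum_div, Finset.sum_add_distrib, a, b]
  have hle := h1.2.2 Pm hPm hsm
  rw [fbMI_eq_s12 Q hQ P1 h1.1.1, fbMI_eq_s12 Q hQ Pm hPm.1] at hle
  have hhom : ∑ y', GG (fun x y => Q x y' y) (fun x => P1 x y' + P2 x y') = 2 * FF Q Pm := by
    unfold FF
    rw [Finset.mul_sum]
    refine Finset.sum_congr rfl fun y' _ => ?_
    rw [← GG_smul _ (fun x => hQ.2 x y')]
    congr 1
    ext x
    simp only [Pm]; ring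
  have hsum : ∑ y', (GG (fun x y => Q x y' y) (fun x => P1 x y') +
      GG (fun x y => Q x y' y) (fun x => P2 x y'))
      = ∑ y', GG (fun x y => Q x y' y) (fun x => P1 x y' + P2 x y') := by
    apply le_antisymm (Finset.sum_le_sum hadd)
    rw [hhom, Finset.sum_add_distrib]
    change _ ≤ FF Q P1 + FF Q P2
    linarith
  have heq := (Finset.sum_eq_sum_iff_of_le hadd).1 hsum
  have hcond : ∀ y' x, P1 x y' / (∑ x, P1 x y') = P2 x y' / (∑ x, P2 x y') := fun y' =>
    (GG_add (fun x y => Q x y' y) (fun x y => hQ.1 x y' y)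
    (fun x => hQ.2 x y') (hM y') (fun x => P1 x y') (fun x => P2 x y')
    (fun x => h1.1.1 x y') (fun x => h2.1.1 x y') (hS1 y') (hS2 y')).2 (heq y' (Finset.mem_univ _))
  have hK : ∀ y' y, condOut Q P1 y' y = condOut Q P2 y' y := by
    intro y' y
    unfold condOut
    rw [Finset.sum_div, Finset.sum_div]
    refine Finset.sum_congr rfl fun x _ => ?_
    rw [mul_div_right_comm, mul_div_right_comm, hcond]
  have hstat : ∀ P, IsFbMaximizer Q P → (∀ y, 0 < ∑ x, P x y) → ∀ y,
      ∑ y', (∑ x, P x y') * condOut Q P y' y = ∑ x, P x y := by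
    intro P hP hS y
    rw [← hP.2.1 y, Finset.sum_comm]
    refine Finset.sum_congr rfl fun y' _ => ?_
    unfold condOut
    rw [mul_div_cancel₀ _ (hS y').ne']
  set d : α → ℝ := fun y => ∑ x, P1 x y - ∑ x, P2 x y with hd
  have hd0 : ∑ y, d y = 0 := by
    have a := h1.1.2
    have b := h2.1.2
    rw [Finset.sum_comm] at a b
    simp only [hd, Finset.sum_sub_distrib, a, b, sub_self]
  have hdK : ∀ y, d y = ∑ y', d y' * (condOut Q P1 y' y - r y) := by
    intro y
    simp only [mul_sub, Finset.sum_sub_distrib]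
    rw [← Finset.sum_mul, hd0, zero_mul, sub_zero]
    simp only [hd, sub_mul, Finset.sum_sub_distrib]
    rw [hstat P1 h1 hS1]
    simp only [hK]
    rw [hstat P2 h2 hS2]
  have hN : (0 : ℝ) < Fintype.card α := by exact_mod_cast Fintype.card_pos
  have hdb : ∑ y, |d y| ≤ (∑ y, |d y|) / 2 := by
    calc ∑ y, |d y| ≤ ∑ _y : α, ∑ y', |d y'| * (1 / (2 * Fintype.card α)) := by
          refine Finset.sum_le_sum fun y _ => ?_
          rw [hdK y]
          refine (Finset.abs_sum_le_sum_abs _ _).trans (Finset.sum_le_sum fun y' _ => ?_)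
          rw [abs_mul]
          exact mul_le_mul_of_nonneg_left (hr y' y) (abs_nonneg _)
      _ = _ := by
          rw [← Finset.sum_mul]
          simp
          field_simp
  have hdz : ∑ y, |d y| = 0 :=
    le_antisymm (by linarith) (Finset.sum_nonneg fun y _ => abs_nonneg _)
  have hdy : ∀ y, ∑ x, P1 x y = ∑ x, P2 x y := by
    intro y
    have := (Finset.sum_eq_zero_iff_of_nonneg (fun y _ => abs_nonneg (d y))).1 hdz y (Finset.mem_univ y)
    exact sub_eq_zero.1 (abs_eq_zero.1 this)
  ext x y
  have := hcond y x
  rw [hdy y] at this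
  exact (div_left_inj' (hS2 y).ne').1 this

end Helpers

/-- For a memoryless surjective channel `W` with `|𝒳| = |𝒴|`
(both alphabets the same finite set `α`), for small enough `δ` the unique maximizer
`P*` of the feedback problem is simulable without feedback: for every `n` and every
initial state `y₀` there is a strictly positive pmf on `𝒳^n` whose output law through
`Q` is the Markov law generated by `P*_{Y|Y'}`. -/
theorem markov_output_simulable
    {α : Type*} [Fintype α] [DecidableEq α] (hα : 2 ≤ Fintype.card α)
    (W : α → α → ℝ) (hW0 : ∀ x y, 0 ≤ W x y) (hW1 : ∀ x, ∑ y : α, W x y = 1)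
    (pX : α → ℝ) (hpX : IsPmf pX)
    (hpXopt : ∀ p : α → ℝ, IsPmf p → mlMI W p ≤ mlMI W pX)
    (hpos : ∀ x, 0 < pX x)
    (hinv : IsUnit ((Matrix.of fun y x => W x y) : Matrix α α ℝ)) :
    ∃ δ > (0 : ℝ), ∀ Q : α → α → α → ℝ, IsPOST Q →
      (∀ x y' y, |Q x y' y - W x y| ≤ δ) →
      (∃! P : α → α → ℝ, IsFbMaximizer Q P) ∧
      ∀ Pstar : α → α → ℝ, IsFbMaximizer Q Pstar →
        ∀ n : ℕ, 0 < n → ∀ y0 : α,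
          ∃ p : (Fin n → α) → ℝ,
            (∀ xs, 0 < p xs) ∧ (∑ xs : Fin n → α, p xs = 1) ∧
            ∀ ys : Fin n → α,
              (∑ xs : Fin n → α,
                  p xs * ∏ t : Fin n, Q (xs t) (prevState n y0 ys t) (ys t)) =
                ∏ t : Fin n, condOut Q Pstar (prevState n y0 ys t) (ys t) := by
  classical
  have hne : Nonempty α := Fintype.card_pos_iff.1 (by omega)
  have hN : (0 : ℝ) < Fintype.card α := by exact_mod_cast Fintype.card_pos
  set Q0 : α → α → α → ℝ := fun x _ y => W x y with hQ0
  set r : α → ℝ := fun y => ∑ x', pX x' * W x' y with hr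
  set P0 : α → α → ℝ := fun x y => pX x * r y with hP0
  have hrpos : ∀ y, 0 < r y := by
    intro y
    have hnn : ∀ x ∈ Finset.univ, 0 ≤ pX x * W x y := fun x _ => mul_nonneg (hpX.1 x) (hW0 x y)
    refine lt_of_le_of_ne (Finset.sum_nonneg hnn) (fun h => ?_)
    have hz := (Finset.sum_eq_zero_iff_of_nonneg hnn).1 h.symm
    have hdet : (Matrix.of fun y x => W x y : Matrix α α ℝ).det = 0 := by
      apply Matrix.det_eq_zero_of_row_eq_zero y
      intro x
      exact (mul_eq_zero.1 (hz x (Finset.mem_univ x))).resolve_left (hpos x).ne'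
    have := (Matrix.isUnit_iff_isUnit_det _).1 hinv
    rw [hdet] at this
    exact not_isUnit_zero this
  have hS0 : ∀ y, ∑ x, P0 x y = r y := by
    intro y
    simp only [hP0]
    rw [← Finset.sum_mul, hpX.2, one_mul]
  have hK0 : ∀ y' y, condOut Q0 P0 y' y = r y := by
    intro y' y
    unfold condOut
    rw [hS0, div_eq_iff (hrpos y').ne', Finset.sum_mul]
    exact Finset.sum_congr rfl fun x _ => by simp only [hP0, hQ0]; ring
  have hMat0 : ∀ y0, Mat Q0 y0 = Matrix.of fun y x => W x y := fun _ => rfl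
  have hdet0 : ∀ y0, (Mat Q0 y0).det ≠ 0 := fun y0 =>
    ((Matrix.isUnit_iff_isUnit_det _).1 hinv).ne_zero
  set A0 : α → α → ℝ := fun x y1 => (Matrix.of fun y x => W x y : Matrix α α ℝ)⁻¹ x y1 * r y1 with hA0
  have hAA0 : ∀ y0 x y1, AA Q0 P0 y0 x y1 = A0 x y1 := by
    intro y0 x y1
    unfold AA
    rw [hK0, hMat0]
  have hA0sum : ∀ x, ∑ y1, A0 x y1 = pX x := by
    intro x
    have h : (Matrix.of fun y x => W x y : Matrix α α ℝ)⁻¹.mulVec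
        ((Matrix.of fun y x => W x y : Matrix α α ℝ).mulVec pX) = pX := by
      rw [Matrix.mulVec_mulVec, Matrix.nonsing_inv_mul _ ((Matrix.isUnit_iff_isUnit_det _).1 hinv),
        Matrix.one_mulVec]
    have hx := congrFun h x
    rw [← hx]
    simp only [hA0, hr, Matrix.mulVec, dotProduct, Matrix.of_apply]
    refine Finset.sum_congr rfl fun y _ => ?_
    congr 1
    exact Finset.sum_congr rfl fun x _ => mul_comm _ _
  -- continuity
  have cS : ∀ y, Continuous (fun z : (α → α → α → ℝ) × (α → α → ℝ) => ∑ x, z.2 x y) := by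
    intro y; fun_prop
  have cK : ∀ y' y, ContinuousAt
      (fun z : (α → α → α → ℝ) × (α → α → ℝ) => condOut z.1 z.2 y' y) (Q0, P0) := by
    intro y' y
    unfold condOut
    refine ContinuousAt.div (by fun_prop) (cS y').continuousAt ?_
    show ∑ x, P0 x y' ≠ 0
    rw [hS0]; exact (hrpos y').ne'
  have cM : ∀ y0, Continuous (fun z : (α → α → α → ℝ) × (α → α → ℝ) => Mat z.1 y0) := by
    intro y0
    unfold Mat
    refine continuous_matrix fun i j => ?_
    simp only [Matrix.of_apply]
    fun_prop
  have cD : ∀ y0, Continuous (fun z : (α → α → α → ℝ) × (α → α → ℝ) => (Mat z.1 y0).det) :=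
    fun y0 => (cM y0).matrix_det
  have cA : ∀ y0 x y1, ContinuousAt
      (fun z : (α → α → α → ℝ) × (α → α → ℝ) => AA z.1 z.2 y0 x y1) (Q0, P0) := by
    intro y0 x y1
    unfold AA
    refine ContinuousAt.mul ?_ (cK y0 y1)
    simp only [Matrix.inv_def, Matrix.smul_apply, smul_eq_mul, Ring.inverse_eq_inv']
    exact ContinuousAt.mul ((cD y0).continuousAt.inv₀ (hdet0 y0))
      (((cM y0).matrix_adjugate).matrix_elem x y1).continuousAt
  -- constants
  obtain ⟨x0, hx0⟩ := Finite.exists_min pX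
  set m : ℝ := pX x0 / 4 with hmd
  have hm : 0 < m := by have := hpos x0; positivity
  have hm2 : ∀ x, 2 * m < pX x := by
    intro x; have := hx0 x; have := hpos x0; simp only [hmd]; linarith
  set C : ℝ := 1 + ∑ x, ∑ y, |A0 x y| with hCd
  have hCnn : 0 ≤ ∑ x, ∑ y, |A0 x y| :=
    Finset.sum_nonneg fun x _ => Finset.sum_nonneg fun y _ => abs_nonneg _
  have hC : 0 < C := by linarith
  have hCA : ∀ x y, |A0 x y| + 1 ≤ C := by
    intro x y
    have a : |A0 x y| ≤ ∑ y, |A0 x y| :=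
      Finset.single_le_sum (f := fun y => |A0 x y|) (fun i _ => abs_nonneg _) (Finset.mem_univ y)
    have b : ∑ y, |A0 x y| ≤ ∑ x, ∑ y, |A0 x y| :=
      Finset.single_le_sum (f := fun x => ∑ y, |A0 x y|)
        (fun i _ => Finset.sum_nonneg fun y _ => abs_nonneg _) (Finset.mem_univ x)
    linarith
  set N : ℝ := (Fintype.card α : ℝ) with hNd
  set ε : ℝ := m / (N * C) with hεd
  have hε : 0 < ε := by positivity
  set η : ℝ := ε * m / (N * (1 + ε)) with hηd
  have hη : 0 < η := by positivity
  have hc1 : N * (C * ε) ≤ m := by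
    apply le_of_eq; rw [hεd]; field_simp
  have hc2 : N * (η * (1 + ε)) ≤ ε * m := by
    apply le_of_eq; rw [hηd]; field_simp
  have hU : ∀ᶠ z : (α → α → α → ℝ) × (α → α → ℝ) in nhds (Q0, P0),
      (∀ y0, (Mat z.1 y0).det ≠ 0) ∧
      (∀ y0 x y1, |AA z.1 z.2 y0 x y1 - A0 x y1| < min (η / 2) 1) ∧
      (∀ y0 x, 2 * m < ∑ y1, AA z.1 z.2 y0 x y1) ∧
      (∀ y, 0 < ∑ x, z.2 x y) ∧
      (∀ y' y, |condOut z.1 z.2 y' y - r y| < 1 / (2 * N)) := by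
    refine Filter.Eventually.and ?_ (Filter.Eventually.and ?_ (Filter.Eventually.and ?_
      (Filter.Eventually.and ?_ ?_)))
    · exact Filter.eventually_all.2 fun y0 => (cD y0).continuousAt.eventually_ne (hdet0 y0)
    · refine Filter.eventually_all.2 fun y0 => Filter.eventually_all.2 fun x =>
        Filter.eventually_all.2 fun y1 => ?_
      have : ContinuousAt (fun z : (α → α → α → ℝ) × (α → α → ℝ) =>
          |AA z.1 z.2 y0 x y1 - A0 x y1|) (Q0, P0) := ((cA y0 x y1).sub continuousAt_const).abs
      refine this.eventually_lt continuousAt_const ?_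
      simp only [hAA0, sub_self, abs_zero]
      positivity
    · refine Filter.eventually_all.2 fun y0 => Filter.eventually_all.2 fun x => ?_
      have : ContinuousAt (fun z : (α → α → α → ℝ) × (α → α → ℝ) =>
          ∑ y1, AA z.1 z.2 y0 x y1) (Q0, P0) :=
        tendsto_finsetSum _ fun y1 _ => cA y0 x y1
      refine continuousAt_const.eventually_lt this ?_
      simp only [hAA0, hA0sum]
      exact hm2 x
    · refine Filter.eventually_all.2 fun y => ?_
      refine continuousAt_const.eventually_lt (cS y).continuousAt ?_
      simp only [hS0]
      exact hrpos y
    · refine Filter.eventually_all.2 fun y' => Filter.eventually_all.2 fun y => ?_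
      have : ContinuousAt (fun z : (α → α → α → ℝ) × (α → α → ℝ) =>
          |condOut z.1 z.2 y' y - r y|) (Q0, P0) := ((cK y' y).sub continuousAt_const).abs
      refine this.eventually_lt continuousAt_const ?_
      simp only [hK0, sub_self, abs_zero]
      positivity
  obtain ⟨δ, hδ, hclose⟩ := max_close W hW0 hW1 pX hpX hpXopt hinv _ hU
  refine ⟨δ, hδ, fun Q hQ hQW => ?_⟩
  have hcl := hclose Q hQ hQW
  refine ⟨?_, ?_⟩
  · obtain ⟨P, hP⟩ := exists_max pX hpX Q hQ
    refine ⟨P, hP, fun P' hP' => ?_⟩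
    obtain ⟨a1, -, -, a4, a5⟩ := hcl P hP
    obtain ⟨-, -, -, b4, b5⟩ := hcl P' hP'
    have hM : ∀ y0, IsUnit (Mat Q y0) := fun y0 =>
      (Matrix.isUnit_iff_isUnit_det _).2 (isUnit_iff_ne_zero.2 (a1 y0))
    exact unique_max Q hQ hM r P' P hP' hP b4 a4 (fun y' y => (b5 y' y).le)
  · intro P hP n _ y0
    obtain ⟨a1, a2, a3, a4, a5⟩ := hcl P hP
    simp only at a1 a2 a3 a4 a5
    have hM : ∀ y0, IsUnit (Mat Q y0) := fun y0 =>
      (Matrix.isUnit_iff_isUnit_det _).2 (isUnit_iff_ne_zero.2 (a1 y0))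
    refine ⟨vv (AA Q P) n y0, fun xs => ?_, ?_, ?_⟩
    · refine (vv_bounds (AA Q P) m C ε η hm hε (fun y x => (a3 y x).le) ?_ ?_ hc1 hc2 n xs).1 y0
      · intro y x y1
        have h1 := (a2 y x y1).trans_le (min_le_right _ _)
        have h2 := hCA x y1
        have h3 := abs_sub_abs_le_abs_sub (AA Q P y x y1) (A0 x y1)
        linarith
      · intro y y' x y1
        have h1 := abs_lt.1 ((a2 y x y1).trans_le (min_le_left _ _))
        have h2 := abs_lt.1 ((a2 y' x y1).trans_le (min_le_left _ _))
        rw [abs_le]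
        constructor <;> linarith [h1.1, h1.2, h2.1, h2.2]
    · exact vv_sum (AA Q P) (condOut Q P) (fun y => condOut_sum Q hQ P y (a4 y))
        (AA_sum Q hQ P hM) n y0
    · exact vv_out Q (AA Q P) (condOut Q P) (AA_out Q P hM) n y0
end
end
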